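/- arXiv:2506.19043 — 3 statements merged into one kernel-verified Lean document; each statement's English description precedes it below -/
import Mathlib

section
/- Let X be a complete median space of finite rank that contains no facing triple, i.e. no three pairwise disjoint halfspaces. Then the topology on X generated by the open halfspaces of X coincides with the metric topology of X. -/
open Set Metric MeasureTheory

/-- The metric interval `[a,b]` in a metric space. -/
def mInterval {X : Type*} [MetricSpace X] (a b : X) : Set X :=
  {c : X | dist a b = dist a c + dist c b}

/-- A median space: each triple of points has a unique median point. -/
def IsMedianSpace (X : Type*) [MetricSpace X] : Prop :=
  ∀ x y z : X, ∃! m : X, m ∈ mInterval x y ∧ m ∈ mInterval x z ∧ m ∈ mInterval y z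

/-- Convexity with respect to metric intervals. -/
def MedConvex {X : Type*} [MetricSpace X] (C : Set X) : Prop :=
  ∀ a ∈ C, ∀ b ∈ C, mInterval a b ⊆ C

/-- A halfspace: a subset such that it and its complement are convex. -/
def IsHalfspace {X : Type*} [MetricSpace X] (h : Set X) : Prop :=
  MedConvex h ∧ MedConvex hᶜ

/-- Two halfspaces are transverse. -/
def Transverse {X : Type*} [MetricSpace X] (h₁ h₂ : Set X) : Prop :=
  (h₁ ∩ h₂).Nonempty ∧ (h₁ ∩ h₂ᶜ).Nonempty ∧ (h₁ᶜ ∩ h₂).Nonempty ∧ (h₁ᶜ ∩ h₂ᶜ).Nonempty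

/-- Finite rank: a uniform bound on families of pairwise transverse halfspaces. -/
def HasFiniteRank (X : Type*) [MetricSpace X] : Prop :=
  ∃ n : ℕ, ∀ H : Set (Set X), (∀ h ∈ H, IsHalfspace h) → H.Pairwise Transverse →
    H.Finite ∧ H.ncard ≤ n

namespace MedProof

variable {X : Type*} [MetricSpace X]

lemma mem_iv {a b c : X} : c ∈ mInterval a b ↔ dist a b = dist a c + dist c b := Iff.rfl

lemma iv_symm {a b c : X} (h : c ∈ mInterval a b) : c ∈ mInterval b a := by
  rw [mem_iv] at *
  rw [dist_comm b a, dist_comm b c, dist_comm c a]; linarith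

lemma iv_left (a b : X) : a ∈ mInterval a b := by rw [mem_iv]; simp
lemma iv_right (a b : X) : b ∈ mInterval a b := by rw [mem_iv]; simp

/-- order along a geodesic: `a, d, c, b` -/
lemma iv_trans {a b c d : X} (hc : c ∈ mInterval a b) (hd : d ∈ mInterval a c) :
    d ∈ mInterval a b ∧ c ∈ mInterval d b := by
  rw [mem_iv] at hc hd
  rw [mem_iv, mem_iv]
  have h1 := dist_triangle a d b
  have h2 := dist_triangle d c b
  constructor <;> linarith

lemma iv_antisymm {a b c : X} (h1 : b ∈ mInterval a c) (h2 : a ∈ mInterval b c) : a = b := by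
  rw [mem_iv] at *
  rw [dist_comm b a] at h2
  exact dist_le_zero.1 (by linarith)

/-- if `w ∈ [u,v]` and `g ∈ [w,u] ∩ [w,v]` then `g = w`. -/
lemma iv_pinch {u v w g : X} (hw : w ∈ mInterval u v) (h1 : g ∈ mInterval w u)
    (h2 : g ∈ mInterval w v) : g = w := by
  rw [mem_iv] at *
  have h3 := dist_triangle u g v
  rw [dist_comm w u, dist_comm g u] at h1
  have : dist w g ≤ 0 := by linarith
  exact (dist_le_zero.1 this).symm

noncomputable def med (hmed : IsMedianSpace X) (x y z : X) : X := (hmed x y z).choose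

lemma med_xy (hmed : IsMedianSpace X) (x y z : X) : med hmed x y z ∈ mInterval x y :=
  (hmed x y z).choose_spec.1.1
lemma med_xz (hmed : IsMedianSpace X) (x y z : X) : med hmed x y z ∈ mInterval x z :=
  (hmed x y z).choose_spec.1.2.1
lemma med_yz (hmed : IsMedianSpace X) (x y z : X) : med hmed x y z ∈ mInterval y z :=
  (hmed x y z).choose_spec.1.2.2
lemma med_unique (hmed : IsMedianSpace X) {x y z t : X} (h1 : t ∈ mInterval x y)
    (h2 : t ∈ mInterval x z) (h3 : t ∈ mInterval y z) : t = med hmed x y z :=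
  (hmed x y z).choose_spec.2 t ⟨h1, h2, h3⟩

def Gate (C : Set X) (x p : X) : Prop := p ∈ C ∧ ∀ c ∈ C, p ∈ mInterval x c

lemma Gate.lip {C : Set X} {x y p q : X} (hp : Gate C x p) (hq : Gate C y q) :
    dist p q ≤ dist x y := by
  have h1 := mem_iv.1 (hp.2 q hq.1)
  have h2 := mem_iv.1 (hq.2 p hp.1)
  have h3 := dist_triangle x y q
  have h4 := dist_triangle y x p
  rw [dist_comm q p] at h2
  rw [dist_comm y x] at h4
  linarith

lemma Gate.unique {C : Set X} {x p q : X} (hp : Gate C x p) (hq : Gate C x q) : p = q := by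
  have := hp.lip hq
  rw [dist_self] at this
  exact dist_le_zero.1 this

lemma Gate.self {C : Set X} {x : X} (hx : x ∈ C) : Gate C x x := ⟨hx, fun c _ => iv_left x c⟩

lemma gate_iv (hmed : IsMedianSpace X) (a b z : X) : Gate (mInterval a b) z (med hmed a b z) := by
  refine ⟨med_xy hmed a b z, fun c hc => ?_⟩
  set p := med hmed a c z with hp
  set q := med hmed b c z with hq
  have hpa : p ∈ mInterval a c := med_xy hmed a c z
  have hqb : q ∈ mInterval b c := med_xy hmed b c z
  have hpza : p ∈ mInterval z a := iv_symm (med_xz hmed a c z)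
  have hqzb : q ∈ mInterval z b := iv_symm (med_xz hmed b c z)
  have hpzc : p ∈ mInterval z c := iv_symm (med_yz hmed a c z)
  set m := med hmed z p q with hm
  have hmp : m ∈ mInterval z p := med_xy hmed z p q
  have hmq : m ∈ mInterval z q := med_xz hmed z p q
  have hmpq : m ∈ mInterval p q := med_yz hmed z p q
  -- p, q ∈ [a,b]
  have h1 : p ∈ mInterval a b ∧ c ∈ mInterval p b := iv_trans hc hpa
  have h2 : q ∈ mInterval b p ∧ _ := iv_trans (iv_symm h1.2) hqb
  have h3 : m ∈ mInterval p b := (iv_trans (iv_symm h2.1) hmpq).1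
  have h4 : m ∈ mInterval b a := (iv_trans (iv_symm h1.1) (iv_symm h3)).1
  have : m = med hmed a b z := med_unique hmed (iv_symm h4)
    (iv_symm (iv_trans hpza hmp).1) (iv_symm (iv_trans hqzb hmq).1)
  rw [← this]
  exact (iv_trans hpzc hmp).1

lemma iv_convex (hmed : IsMedianSpace X) (a b : X) : MedConvex (mInterval a b) := by
  intro u hu v hv w hw
  have hg := gate_iv hmed a b w
  have := iv_pinch hw (hg.2 u hu) (hg.2 v hv)
  rw [← this]; exact hg.1

lemma med_of_mem (hmed : IsMedianSpace X) {a b z : X} (h : z ∈ mInterval a b) :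
    med hmed a b z = z :=
  (gate_iv hmed a b z).unique (Gate.self h)

lemma med_lip (hmed : IsMedianSpace X) (a b z w : X) :
    dist (med hmed a b z) (med hmed a b w) ≤ dist z w :=
  (gate_iv hmed a b z).lip (gate_iv hmed a b w)

lemma med_rot (hmed : IsMedianSpace X) (a b c : X) : med hmed a b c = med hmed b c a :=
  med_unique hmed (med_yz hmed a b c) (iv_symm (med_xy hmed a b c)) (iv_symm (med_xz hmed a b c))

/-! ### Joins and separation -/

def join (x : X) (A : Set X) : Set X := {w | ∃ a ∈ A, w ∈ mInterval x a}

lemma join_aux (hmed : IsMedianSpace X) {x a u w w' : X} (hu : u ∈ mInterval x a)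
    (h1 : w' ∈ mInterval w x) (h2 : w' ∈ mInterval w a) : w' ∈ mInterval w u := by
  set t := med hmed w' x a with ht
  have a1 := iv_trans (iv_symm h1) (iv_symm (med_xy hmed w' x a))
  have a2 := iv_trans (iv_symm h2) (iv_symm (med_xz hmed w' x a))
  have e : t = med hmed x a w := med_unique hmed (med_yz hmed w' x a) a1.1 a2.1
  have g : t ∈ mInterval w u := by rw [e]; exact (gate_iv hmed x a w).2 u hu
  exact (iv_trans g (iv_symm a1.2)).1

lemma join_convex (hmed : IsMedianSpace X) (x : X) {A : Set X} (hA : MedConvex A) :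
    MedConvex (join x A) := by
  rintro u ⟨a, ha, hu⟩ v ⟨a', ha', hv⟩ w hw
  have hg := gate_iv hmed a a' w
  set b := med hmed a a' w with hb
  refine ⟨b, hA a ha a' ha' hg.1, ?_⟩
  have hw' := gate_iv hmed x b w
  set w' := med hmed x b w with hw'd
  have h1 : w' ∈ mInterval w x := hw'.2 x (iv_left _ _)
  have h2 : w' ∈ mInterval w b := hw'.2 b (iv_right _ _)
  have h3 : w' ∈ mInterval w a := (iv_trans (hg.2 a (iv_left _ _)) h2).1
  have h4 : w' ∈ mInterval w a' := (iv_trans (hg.2 a' (iv_right _ _)) h2).1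
  have := iv_pinch hw (join_aux hmed hu h1 h3) (join_aux hmed hv h1 h4)
  rw [← this]; exact hw'.1

lemma max_convex {A B : Set X} (hA : MedConvex A) (hAB : Disjoint A B) :
    ∃ M, A ⊆ M ∧ MedConvex M ∧ Disjoint M B ∧
      ∀ N, MedConvex N → Disjoint N B → M ⊆ N → N = M := by
  obtain ⟨M, hAM, hM⟩ := zorn_subset_nonempty {M : Set X | MedConvex M ∧ Disjoint M B} (by
    intro c hc hch hne
    refine ⟨⋃₀ c, ⟨?_, ?_⟩, fun s hs => subset_sUnion_of_mem hs⟩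
    · rintro a ⟨s, hs, has⟩ b ⟨t, ht, hbt⟩
      rcases hch.total hs ht with h | h
      · exact ((hc ht).1 a (h has) b hbt).trans (subset_sUnion_of_mem ht)
      · exact ((hc hs).1 a has b (h hbt)).trans (subset_sUnion_of_mem hs)
    · rw [disjoint_sUnion_left]
      exact fun s hs => (hc hs).2) A ⟨hA, hAB⟩
  refine ⟨M, hAM, hM.prop.1, hM.prop.2, fun N h1 h2 h3 => ?_⟩
  exact (hM.eq_of_subset ⟨h1, h2⟩ h3).symm

lemma separation (hmed : IsMedianSpace X) {A B : Set X} (hA : MedConvex A) (hB : MedConvex B)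
    (hAB : Disjoint A B) : ∃ h, IsHalfspace h ∧ A ⊆ h ∧ B ⊆ hᶜ := by
  rcases A.eq_empty_or_nonempty with rfl | ⟨a0, ha0⟩
  · refine ⟨∅, ⟨?_, ?_⟩, Subset.rfl, by simp⟩
    · intro a ha; exact ha.elim
    · intro a _ b _ c _; simp
  rcases B.eq_empty_or_nonempty with rfl | ⟨b0, hb0⟩
  · refine ⟨univ, ⟨?_, ?_⟩, by simp, by simp⟩
    · intro a _ b _ c _; simp
    · intro a ha; simp at ha
  obtain ⟨M, hAM, hMc, hMB, hMmax⟩ := max_convex hA hAB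
  obtain ⟨N, hBN, hNc, hNM, hNmax⟩ := max_convex hB hMB.symm
  have hcompl : N = Mᶜ := by
    apply Subset.antisymm (subset_compl_iff_disjoint_right.2 hNM)
    intro x hx
    by_contra hxN
    have h1 : ¬ Disjoint (join x M) B := by
      intro hd
      have := hMmax _ (join_convex hmed x hMc) hd (fun a ha => ⟨a, ha, iv_right _ _⟩)
      apply hx
      rw [← this]
      exact ⟨a0, hAM ha0, iv_left _ _⟩
    have h2 : ¬ Disjoint (join x N) M := by
      intro hd
      have := hNmax _ (join_convex hmed x hNc) hd (fun a ha => ⟨a, ha, iv_right _ _⟩)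
      apply hxN
      rw [← this]
      exact ⟨b0, hBN hb0, iv_left _ _⟩
    obtain ⟨b', ⟨a, ha, hb'⟩, hb'B⟩ := not_disjoint_iff.1 h1
    obtain ⟨a', ⟨b, hb, ha'⟩, ha'M⟩ := not_disjoint_iff.1 h2
    have g1 := (gate_iv hmed x a b).2 b' hb'
    have g2 := (gate_iv hmed x b a).2 a' ha'
    have e : med hmed x a b = med hmed x b a :=
      med_unique hmed (med_xz hmed x a b) (med_xy hmed x a b) (iv_symm (med_yz hmed x a b))
    rw [← e] at g2
    exact disjoint_left.1 hNM (hNc b hb b' (hBN hb'B) g1) (hMc a ha a' ha'M g2)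
  refine ⟨M, ⟨hMc, hcompl ▸ hNc⟩, hAM, hcompl ▸ hBN⟩

lemma singleton_convex (x : X) : MedConvex ({x} : Set X) := by
  intro a ha b hb c hc
  rw [mem_singleton_iff] at ha hb ⊢
  rw [ha, hb, mem_iv, dist_self, dist_comm x c] at hc
  have := dist_nonneg (x := c) (y := x)
  exact (dist_le_zero.1 (by linarith : dist c x ≤ 0))

lemma hs_compl {h : Set X} (hh : IsHalfspace h) : IsHalfspace hᶜ :=
  ⟨hh.2, by rw [compl_compl]; exact hh.1⟩

lemma sep_points (hmed : IsMedianSpace X) {x y : X} (hxy : x ≠ y) :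
    ∃ h, IsHalfspace h ∧ x ∈ h ∧ y ∉ h := by
  obtain ⟨h, h1, h2, h3⟩ := separation hmed (singleton_convex x) (singleton_convex y)
    (by simpa using hxy)
  exact ⟨h, h1, h2 rfl, h3 rfl⟩

/-! ### Minimal halfspaces and the quantitative separation -/

lemma min_halfspace {x y : X} {k : Set X} (hk : IsHalfspace k) (hy : y ∈ k) (hx : x ∉ k) :
    ∃ h, h ⊆ k ∧ Minimal (fun h => IsHalfspace h ∧ y ∈ h ∧ x ∉ h) h := by
  obtain ⟨M, hAM, hM⟩ := zorn_superset_nonempty {h : Set X | IsHalfspace h ∧ y ∈ h ∧ x ∉ h} (by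
    intro c hc hch ⟨s0, hs0⟩
    refine ⟨⋂₀ c, ⟨⟨?_, ?_⟩, ?_, ?_⟩, fun s hs => sInter_subset_of_mem hs⟩
    · intro a ha b hb w hw s hs
      exact (hc hs).1.1 a (ha s hs) b (hb s hs) hw
    · intro a ha b hb w hw hw'
      simp only [mem_compl_iff, mem_sInter, not_forall] at ha hb
      obtain ⟨s, hs, has⟩ := ha
      obtain ⟨t, ht, hbt⟩ := hb
      rcases hch.total hs ht with h | h
      · exact (hc hs).1.2 a has b (fun h' => hbt (h h')) hw (hw' s hs)
      · exact (hc ht).1.2 a (fun h' => has (h h')) b hbt hw (hw' t ht)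
    · exact fun s hs => (hc hs).2.1
    · exact fun h => (hc hs0).2.2 (h s0 hs0)) k ⟨hk, hy, hx⟩
  exact ⟨M, hAM, hM⟩

lemma join_points (hmed : IsMedianSpace X) {x y : X} {δ : ℝ} (S : Finset (Set X))
    (hS : ∀ h ∈ S, IsHalfspace h ∧ y ∈ h ∧ ∃ z ∈ h, dist x z < δ) :
    ∃ q ∈ mInterval x y, (∀ h ∈ S, q ∈ h) ∧ dist x q ≤ S.card * δ := by
  classical
  induction S using Finset.induction_on with
  | empty => exact ⟨x, iv_left _ _, by simp, by simp⟩
  | insert h S hnot ih =>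
    obtain ⟨q0, hq0, hq0S, hd0⟩ := ih (fun k hk => hS k (Finset.mem_insert_of_mem hk))
    obtain ⟨hh, hy, z, hz, hxz⟩ := hS h (Finset.mem_insert_self _ _)
    set z' := med hmed x y z with hz'
    have hz'h : z' ∈ h := hh.1 y hy z hz (med_yz hmed x y z)
    have hz'xy : z' ∈ mInterval x y := med_xy hmed x y z
    have hz'd : dist x z' ≤ dist x z := by
      have := med_lip hmed x y x z
      rwa [med_of_mem hmed (iv_left x y)] at this
    have hg := gate_iv hmed q0 y z'
    set q := med hmed q0 y z' with hq
    have hqxy : q ∈ mInterval x y := iv_convex hmed x y q0 hq0 y (iv_right _ _) hg.1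
    refine ⟨q, hqxy, ?_, ?_⟩
    · intro k hk
      rcases Finset.mem_insert.1 hk with rfl | hk
      · exact hh.1 y hy z' hz'h (med_yz hmed q0 y z')
      · exact (hS k (Finset.mem_insert_of_mem hk)).1.1 q0 (hq0S k hk) y
          (hS k (Finset.mem_insert_of_mem hk)).2.1 hg.1
    · have hgx : Gate (mInterval q0 y) x q0 :=
        ⟨iv_left _ _, fun c hc => by
          have := iv_trans (iv_symm hq0) (iv_symm hc)
          exact iv_symm this.2⟩
      have h1 := hgx.lip hg
      have h2 := dist_triangle x q0 q
      rw [Finset.card_insert_of_notMem hnot]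
      push_cast
      linarith

def RankLE (X : Type*) [MetricSpace X] (n : ℕ) : Prop :=
  ∀ H : Set (Set X), (∀ h ∈ H, IsHalfspace h) → H.Pairwise Transverse →
    H.Finite ∧ H.ncard ≤ n

lemma quant (hmed : IsMedianSpace X) {n : ℕ} (hn : RankLE X n) {x y : X} {δ : ℝ} (hδ : 0 < δ)
    (H : ∀ h, IsHalfspace h → y ∈ h → ∃ z ∈ h, dist x z < δ) : dist x y ≤ n * δ := by
  set M : Set (Set X) := {h | Minimal (fun h => IsHalfspace h ∧ y ∈ h ∧ x ∉ h) h} with hM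
  have mm : ∀ h ∈ M, Minimal (fun h => IsHalfspace h ∧ y ∈ h ∧ x ∉ h) h := fun h hh => hh
  have hfin := hn M (fun h hh => (mm h hh).prop.1) (by
    intro h hh k hk hne
    refine ⟨⟨y, (mm h hh).prop.2.1, (mm k hk).prop.2.1⟩, ?_, ?_, ⟨x, (mm h hh).prop.2.2, (mm k hk).prop.2.2⟩⟩
    · by_contra hcon
      rw [not_nonempty_iff_eq_empty, ← sdiff_eq, sdiff_eq_empty] at hcon
      exact hne ((mm k hk).eq_of_subset (mm h hh).prop hcon)
    · by_contra hcon
      rw [not_nonempty_iff_eq_empty, inter_comm, ← sdiff_eq, sdiff_eq_empty] at hcon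
      exact hne ((mm h hh).eq_of_subset (mm k hk).prop hcon).symm)
  obtain ⟨q, hq, hqM, hqd⟩ := join_points hmed (x := x) (y := y) (δ := δ) hfin.1.toFinset (by
    intro h hh
    rw [Finite.mem_toFinset] at hh
    exact ⟨(mm h hh).prop.1, (mm h hh).prop.2.1, H h (mm h hh).prop.1 (mm h hh).prop.2.1⟩)
  have hqy : q = y := by
    by_contra hne
    obtain ⟨h, hh, hyh, hqh⟩ := sep_points hmed (Ne.symm hne)
    have hxh : x ∉ h := fun hx => hqh (hh.1 x hx y hyh hq)
    obtain ⟨k, hkh, hk⟩ := min_halfspace hh hyh hxh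
    exact hqh (hkh (hqM k (by rw [Finite.mem_toFinset]; exact hk)))
  rw [hqy] at hqd
  refine hqd.trans (mul_le_mul_of_nonneg_right ?_ hδ.le)
  rw [← ncard_eq_toFinset_card M hfin.1]
  exact_mod_cast hfin.2

/-! ### Thick separation -/

def mhull (S : Set X) : Set X := ⋂₀ {C | MedConvex C ∧ S ⊆ C}

lemma mhull_convex (S : Set X) : MedConvex (mhull S) := by
  intro a ha b hb c hc C hC
  exact hC.1 a (ha C hC) b (hb C hC) hc

lemma subset_mhull (S : Set X) : S ⊆ mhull S := fun _ hx _ hC => hC.2 hx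

lemma mhull_ball (hmed : IsMedianSpace X) {n : ℕ} (hn : RankLE X n) {x y : X} {r : ℝ} (hr : 0 < r)
    (hy : y ∈ mhull (ball x r)) : dist x y ≤ n * r := by
  apply quant hmed hn hr
  intro h hh hyh
  by_contra! hcon
  refine hy hᶜ ⟨hh.2, fun z hz hzh => ?_⟩ hyh
  have := hcon z hzh
  rw [mem_ball, dist_comm] at hz
  linarith

lemma thick_sep (hmed : IsMedianSpace X) {n : ℕ} (hn : RankLE X n) {x y : X} (hxy : x ≠ y) :
    ∃ r > 0, ∃ u, IsHalfspace u ∧ ball x r ⊆ u ∧ ball y r ⊆ uᶜ := by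
  have hd : 0 < dist x y := dist_pos.2 hxy
  set r := dist x y / (2 * n + 1) with hr
  have hn0 : (0 : ℝ) < 2 * n + 1 := by positivity
  have hr0 : 0 < r := by positivity
  have hrd : r * (2 * n + 1) = dist x y := by rw [hr]; field_simp
  obtain ⟨u, hu, h1, h2⟩ := separation hmed (mhull_convex (ball x r)) (mhull_convex (ball y r)) (by
    rw [disjoint_left]
    intro z hz hz'
    have h1 := mhull_ball hmed hn hr0 hz
    have h2 := mhull_ball hmed hn hr0 hz'
    have h3 := dist_triangle_right x y z
    nlinarith)
  exact ⟨r, hr0, u, hu, (subset_mhull _).trans h1, (subset_mhull _).trans h2⟩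

lemma med_mono (hmed : IsMedianSpace X) {p q a b c : X} (hc : c ∈ mInterval a b) :
    med hmed p q c ∈ mInterval (med hmed p q a) (med hmed p q b) := by
  by_contra hcon
  obtain ⟨s, hs, h1, h2⟩ := separation hmed
    (iv_convex hmed (med hmed p q a) (med hmed p q b)) (singleton_convex (med hmed p q c))
    (by simpa using hcon)
  have ha : med hmed p q a ∈ s := h1 (iv_left _ _)
  have hb : med hmed p q b ∈ s := h1 (iv_right _ _)
  have hcs : med hmed p q c ∉ s := h2 rfl
  have key : ∀ w, w ∉ s → ∀ z, med hmed p q z ∈ s → (w = p ∨ w = q) → z ∈ s := by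
    intro w hw z hz hwp
    by_contra hzs
    rcases hwp with rfl | rfl
    · exact hs.2 w hw z hzs (med_xz hmed w q z) hz
    · exact hs.2 w hw z hzs (med_yz hmed p w z) hz
  by_cases hp : p ∈ s
  · by_cases hq : q ∈ s
    · exact hcs (hs.1 p hp q hq (med_xy hmed p q c))
    · have := hs.1 a (key q hq a ha (Or.inr rfl)) b (key q hq b hb (Or.inr rfl)) hc
      exact hcs (hs.1 p hp c this (med_xz hmed p q c))
  · by_cases hq : q ∈ s
    · have := hs.1 a (key p hp a ha (Or.inl rfl)) b (key p hp b hb (Or.inl rfl)) hc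
      exact hcs (hs.1 q hq c this (med_yz hmed p q c))
    · exact hs.2 p hp q hq (med_xy hmed p q a) ha

/-! ### Closed convex sets -/

lemma closure_convex (hmed : IsMedianSpace X) {C : Set X} (hC : MedConvex C) :
    MedConvex (closure C) := by
  intro a ha b hb c hc
  rw [Metric.mem_closure_iff] at *
  intro ε hε
  obtain ⟨a', ha', hda⟩ := ha (ε / 2) (by positivity)
  obtain ⟨b', hb', hdb⟩ := hb (ε / 2) (by positivity)
  refine ⟨med hmed a' b' c, hC a' ha' b' hb' (med_xy _ _ _ _), ?_⟩
  have e1 : med hmed b c a = c := by rw [← med_rot, med_of_mem hmed hc]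
  have h1 := med_lip hmed b c a a'
  have h2 := med_lip hmed c a' b b'
  rw [e1] at h1
  rw [← med_rot hmed b c a', ] at h2
  rw [← med_rot hmed b' c a', ← med_rot hmed a' b' c] at h2
  have h3 := dist_triangle c (med hmed b c a') (med hmed a' b' c)
  linarith

lemma iv_closed (a b : X) : IsClosed (mInterval a b) :=
  isClosed_eq continuous_const ((continuous_const.dist continuous_id).add
    (continuous_id.dist continuous_const))

lemma exists_gate [CompleteSpace X] (hmed : IsMedianSpace X) {C : Set X} (hC : MedConvex C)
    (hcl : IsClosed C) (hne : C.Nonempty) (x : X) : ∃ p, Gate C x p := by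
  set D := infDist x C with hD
  have hlow : ∀ c ∈ C, D ≤ dist x c := fun c hc => infDist_le_dist_of_mem hc
  have hex : ∀ k : ℕ, ∃ c ∈ C, dist x c < D + 1 / ((k : ℝ) + 1) := fun k =>
    (infDist_lt_iff hne).1 (lt_add_of_pos_right _ (by positivity))
  choose f hfC hf using hex
  have hcauchy : CauchySeq f := by
    refine cauchySeq_of_le_tendsto_0' (fun k : ℕ => 2 * (1 / ((k : ℝ) + 1))) ?_ ?_
    · intro k l hkl
      have hm := hlow _ (hC _ (hfC k) _ (hfC l) (med_yz hmed x (f k) (f l)))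
      have h1 := mem_iv.1 (med_xy hmed x (f k) (f l))
      have h2 := mem_iv.1 (med_xz hmed x (f k) (f l))
      have h3 := dist_triangle_left (f k) (f l) (med hmed x (f k) (f l))
      have h4 := hf k
      have h5 := hf l
      have h6 : 1 / ((l : ℝ) + 1) ≤ 1 / ((k : ℝ) + 1) := by
        apply one_div_le_one_div_of_le (by positivity)
        have : (k : ℝ) ≤ l := by exact_mod_cast hkl
        linarith
      linarith
    · have := (tendsto_one_div_add_atTop_nhds_zero_nat (𝕜 := ℝ)).const_mul 2
      simpa using this
  obtain ⟨p, hp⟩ := cauchySeq_tendsto_of_complete hcauchy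
  have hpC : p ∈ C := hcl.mem_of_tendsto hp (Filter.Eventually.of_forall hfC)
  have hpD : dist x p ≤ D := by
    have h1 : Filter.Tendsto (fun k => dist x (f k)) Filter.atTop (nhds (dist x p)) :=
      tendsto_const_nhds.dist hp
    have h2 : Filter.Tendsto (fun k : ℕ => D + 1 / ((k : ℝ) + 1)) Filter.atTop (nhds (D + 0)) :=
      (tendsto_one_div_add_atTop_nhds_zero_nat (𝕜 := ℝ)).const_add D
    rw [add_zero] at h2
    exact le_of_tendsto_of_tendsto' h1 h2 (fun k => (hf k).le)
  refine ⟨p, hpC, fun c hc => ?_⟩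
  have hm := hlow _ (hC p hpC c hc (med_yz hmed x p c))
  have h1 := mem_iv.1 (med_xy hmed x p c)
  have : med hmed x p c = p := dist_le_zero.1 (by linarith)
  rw [← this]
  exact med_xz hmed x p c

lemma join_closed [CompleteSpace X] (hmed : IsMedianSpace X) {A : Set X} (hA : MedConvex A)
    (hcl : IsClosed A) (hne : A.Nonempty) (x : X) : IsClosed (join x A) := by
  choose π hπ using fun z => exists_gate hmed hA hcl hne z
  have hcont : Continuous π := by
    refine (LipschitzWith.of_dist_le_mul (K := 1) ?_).continuous
    intro a b
    simpa using (hπ a).lip (hπ b)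
  have : join x A = {w | dist x (π w) = dist x w + dist w (π w)} := by
    ext w
    constructor
    · rintro ⟨a, ha, hw⟩
      have := iv_trans (iv_symm hw) (iv_symm ((hπ w).2 a ha))
      exact iv_symm this.2
    · intro h
      exact ⟨π w, (hπ w).1, h⟩
  rw [this]
  exact isClosed_eq (continuous_const.dist hcont) ((continuous_const.dist continuous_id).add
    (continuous_id.dist hcont))

lemma finite_hull [CompleteSpace X] (hmed : IsMedianSpace X) {D : Set X} (hD : MedConvex D)
    {S : Set X} (hS : S.Finite) (hSD : S ⊆ D) :
    ∃ P, IsClosed P ∧ MedConvex P ∧ S ⊆ P ∧ P ⊆ D := by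
  induction S, hS using Set.Finite.induction_on with
  | empty => exact ⟨∅, isClosed_empty, fun a ha => ha.elim, Subset.rfl, empty_subset _⟩
  | @insert x S _ _ ih =>
    obtain ⟨P, h1, h2, h3, h4⟩ := ih ((subset_insert _ _).trans hSD)
    have hx : x ∈ D := hSD (mem_insert _ _)
    rcases P.eq_empty_or_nonempty with rfl | hne
    · refine ⟨{x}, isClosed_singleton, singleton_convex x, ?_, by simpa using hx⟩
      rw [subset_empty_iff.1 h3]; simp
    · refine ⟨join x P, join_closed hmed h2 h1 hne x, join_convex hmed x h2, ?_, ?_⟩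
      · intro z hz
        rcases mem_insert_iff.1 hz with rfl | hz
        · obtain ⟨a, ha⟩ := hne
          exact ⟨a, ha, iv_left _ _⟩
        · exact ⟨z, h3 hz, iv_right _ _⟩
      · rintro w ⟨a, ha, hw⟩
        exact hD x hx a (h4 ha) hw

lemma thick_sep_sets [CompleteSpace X] (hmed : IsMedianSpace X) {n : ℕ} (hn : RankLE X n)
    {P Q : Set X} (hP : MedConvex P) (hPc : IsClosed P) (hPn : P.Nonempty)
    (hQ : MedConvex Q) (hQc : IsClosed Q) (hQn : Q.Nonempty) (hPQ : Disjoint P Q) :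
    ∃ v, IsHalfspace v ∧ P ⊆ interior v ∧ Q ⊆ interior vᶜ := by
  obtain ⟨p0, hp0⟩ := hPn
  obtain ⟨q, hq⟩ := exists_gate hmed hQ hQc hQn p0
  obtain ⟨p, hp⟩ := exists_gate hmed hP hPc ⟨p0, hp0⟩ q
  have hpq : p ≠ q := fun h => disjoint_left.1 hPQ hp.1 (h ▸ hq.1)
  have hqp : ∀ c ∈ Q, q ∈ mInterval p c := fun c hc =>
    (iv_trans (hq.2 c hc) (iv_symm (hp.2 p0 hp0))).2
  obtain ⟨r, hr, u, hu, h1, h2⟩ := thick_sep hmed hn hpq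
  have eP : ∀ z ∈ P, med hmed p q z = p := fun z hz =>
    (med_unique hmed (iv_left _ _) (iv_left _ _) (hp.2 z hz)).symm
  have eQ : ∀ z ∈ Q, med hmed p q z = q := fun z hz =>
    (med_unique hmed (iv_right _ _) (hqp z hz) (iv_left _ _)).symm
  refine ⟨{z | med hmed p q z ∈ u}, ⟨?_, ?_⟩, ?_, ?_⟩
  · intro a ha b hb c hc
    exact hu.1 _ ha _ hb (med_mono hmed hc)
  · intro a ha b hb c hc
    exact hu.2 _ ha _ hb (med_mono hmed hc)
  · intro z hz
    rw [mem_interior_iff_mem_nhds]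
    refine Filter.mem_of_superset (ball_mem_nhds z hr) (fun w hw => h1 ?_)
    have := med_lip hmed p q w z
    rw [eP z hz] at this
    exact lt_of_le_of_lt this hw
  · intro z hz
    rw [mem_interior_iff_mem_nhds]
    refine Filter.mem_of_superset (ball_mem_nhds z hr) (fun w hw => h2 ?_)
    have := med_lip hmed p q w z
    rw [eQ z hz] at this
    exact lt_of_le_of_lt this hw

/-! ### Halfspaces are open or closed -/

lemma open_or_closed [CompleteSpace X] (hmed : IsMedianSpace X) {n : ℕ} (hn : RankLE X n)
    {h : Set X} (hh : IsHalfspace h) : IsOpen h ∨ IsClosed h := by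
  by_contra! hcon
  obtain ⟨ho, hc⟩ := hcon
  obtain ⟨a, hah, ha⟩ : ∃ a ∈ h, a ∈ closure hᶜ := by
    by_contra! hcon
    apply ho
    rw [← isClosed_compl_iff, ← closure_subset_iff_isClosed]
    exact fun z hz hzh => hcon z hzh hz
  obtain ⟨b, hb, hbh⟩ : ∃ b ∈ closure h, b ∉ h := by
    by_contra! hcon
    exact hc (closure_subset_iff_isClosed.1 hcon)
  have d1 : ∀ z ∈ mInterval a b, ∀ O : Set X, IsOpen O → z ∈ O →
      ∃ z' ∈ mInterval a b, z' ∈ O ∧ z' ∈ h := by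
    intro z hz O hO hzO
    have hzc := closure_convex hmed hh.1 a (subset_closure hah) b hb hz
    obtain ⟨ε, hε, hball⟩ := Metric.isOpen_iff.1 hO z hzO
    obtain ⟨w, hw, hzw⟩ := Metric.mem_closure_iff.1 hzc ε hε
    refine ⟨med hmed a b w, med_xy _ _ _ _, hball ?_, hh.1 a hah w hw (med_xz _ _ _ _)⟩
    have := med_lip hmed a b w z
    rw [med_of_mem hmed hz, dist_comm w z] at this
    exact lt_of_le_of_lt this hzw
  have d2 : ∀ z ∈ mInterval a b, ∀ O : Set X, IsOpen O → z ∈ O →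
      ∃ z' ∈ mInterval a b, z' ∈ O ∧ z' ∈ hᶜ := by
    intro z hz O hO hzO
    have hzc := closure_convex hmed hh.2 a ha b (subset_closure hbh) hz
    obtain ⟨ε, hε, hball⟩ := Metric.isOpen_iff.1 hO z hzO
    obtain ⟨w, hw, hzw⟩ := Metric.mem_closure_iff.1 hzc ε hε
    refine ⟨med hmed a b w, med_xy _ _ _ _, hball ?_, hh.2 b hbh w hw (med_yz _ _ _ _)⟩
    have := med_lip hmed a b w z
    rw [med_of_mem hmed hz, dist_comm w z] at this
    exact lt_of_le_of_lt this hzw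
  have key : ∀ k : ℕ, ∃ H : Set (Set X), H.Finite ∧ H.ncard = k ∧
      (∀ u ∈ H, IsHalfspace u ∧ (mInterval a b ∩ interior u).Nonempty ∧
        (mInterval a b ∩ interior uᶜ).Nonempty) ∧ H.Pairwise Transverse := by
    intro k
    induction k with
    | zero => exact ⟨∅, finite_empty, by simp, by simp, by simp⟩
    | succ k ih =>
      obtain ⟨H, hfin, hcard, hH, hpw⟩ := ih
      have c1 : ∀ u ∈ H, ∃ z ∈ mInterval a b, z ∈ interior u ∧ z ∈ h := fun u hu => by
        obtain ⟨z, hz, hzu⟩ := (hH u hu).2.1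
        exact d1 z hz _ isOpen_interior hzu
      have c2 : ∀ u ∈ H, ∃ z ∈ mInterval a b, z ∈ interior u ∧ z ∈ hᶜ := fun u hu => by
        obtain ⟨z, hz, hzu⟩ := (hH u hu).2.1
        exact d2 z hz _ isOpen_interior hzu
      have c3 : ∀ u ∈ H, ∃ z ∈ mInterval a b, z ∈ interior uᶜ ∧ z ∈ h := fun u hu => by
        obtain ⟨z, hz, hzu⟩ := (hH u hu).2.2
        exact d1 z hz _ isOpen_interior hzu
      have c4 : ∀ u ∈ H, ∃ z ∈ mInterval a b, z ∈ interior uᶜ ∧ z ∈ hᶜ := fun u hu => by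
        obtain ⟨z, hz, hzu⟩ := (hH u hu).2.2
        exact d2 z hz _ isOpen_interior hzu
      have hX : Nonempty X := ⟨a⟩
      choose! f1 hf1 using c1
      choose! f2 hf2 using c2
      choose! f3 hf3 using c3
      choose! f4 hf4 using c4
      obtain ⟨P, hPc, hP, hSP, hPh⟩ := finite_hull hmed hh.1
        (S := insert a (f1 '' H ∪ f3 '' H)) (((hfin.image _).union (hfin.image _)).insert _) (by
          rintro z (rfl | ⟨u, hu, rfl⟩ | ⟨u, hu, rfl⟩)
          · exact hah
          · exact (hf1 u hu).2.2
          · exact (hf3 u hu).2.2)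
      obtain ⟨Q, hQc, hQ, hSQ, hQh⟩ := finite_hull hmed hh.2
        (S := insert b (f2 '' H ∪ f4 '' H)) (((hfin.image _).union (hfin.image _)).insert _) (by
          rintro z (rfl | ⟨u, hu, rfl⟩ | ⟨u, hu, rfl⟩)
          · exact hbh
          · exact (hf2 u hu).2.2
          · exact (hf4 u hu).2.2)
      have haP : a ∈ P := hSP (mem_insert _ _)
      have hbQ : b ∈ Q := hSQ (mem_insert _ _)
      obtain ⟨v, hv, hPv, hQv⟩ := thick_sep_sets hmed hn hP hPc ⟨a, haP⟩ hQ hQc ⟨b, hbQ⟩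
        (disjoint_left.2 fun z hz hz' => hQh hz' (hPh hz))
      have tr : ∀ u ∈ H, Transverse v u := fun u hu =>
        ⟨⟨f1 u, interior_subset (hPv (hSP (Or.inr (Or.inl ⟨u, hu, rfl⟩)))),
            interior_subset (hf1 u hu).2.1⟩,
          ⟨f3 u, interior_subset (hPv (hSP (Or.inr (Or.inr ⟨u, hu, rfl⟩)))),
            interior_subset (hf3 u hu).2.1⟩,
          ⟨f2 u, interior_subset (hQv (hSQ (Or.inr (Or.inl ⟨u, hu, rfl⟩)))),
            interior_subset (hf2 u hu).2.1⟩,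
          ⟨f4 u, interior_subset (hQv (hSQ (Or.inr (Or.inr ⟨u, hu, rfl⟩)))),
            interior_subset (hf4 u hu).2.1⟩⟩
      have tr' : ∀ u ∈ H, Transverse u v := fun u hu => by
        obtain ⟨t1, t2, t3, t4⟩ := tr u hu
        refine ⟨?_, ?_, ?_, ?_⟩ <;> rw [inter_comm] <;> assumption
      have hvH : v ∉ H := fun hvH => by
        obtain ⟨z, hz, hz'⟩ := (tr v hvH).2.1
        exact hz' hz
      refine ⟨insert v H, hfin.insert _, by rw [ncard_insert_of_notMem hvH hfin, hcard], ?_, ?_⟩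
      · rintro u (rfl | hu)
        · exact ⟨hv, ⟨a, iv_left _ _, hPv haP⟩, ⟨b, iv_right _ _, hQv hbQ⟩⟩
        · exact hH u hu
      · rintro u (rfl | hu) w (rfl | hw) hne
        · exact (hne rfl).elim
        · exact tr w hw
        · exact tr' u hu
        · exact hpw hu hw hne
  obtain ⟨H, _, hcard, hH, hpw⟩ := key (n + 1)
  have := (hn H (fun u hu => (hH u hu).1) hpw).2
  omega

lemma closed_sep [CompleteSpace X] (hmed : IsMedianSpace X) {n : ℕ} (hn : RankLE X n)
    {x y : X} (hxy : x ≠ y) : ∃ h, IsHalfspace h ∧ IsClosed h ∧ y ∈ h ∧ x ∉ h := by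
  obtain ⟨k, hk, hyk, hxk⟩ := sep_points hmed hxy.symm
  obtain ⟨h, -, hmin⟩ := min_halfspace hk hyk hxk
  obtain ⟨hh, hyh, hxh⟩ := hmin.prop
  rcases open_or_closed hmed hn hh with ho | hc
  swap
  · exact ⟨h, hh, hc, hyh, hxh⟩
  refine ⟨h, hh, ?_, hyh, hxh⟩
  rw [← closure_subset_iff_isClosed]
  intro b hb
  by_contra hbh
  obtain ⟨q, hq⟩ := exists_gate hmed hh.2 ho.isClosed_compl ⟨x, hxh⟩ y
  have hqy : y ≠ q := fun e => hq.1 (e ▸ hyh)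
  obtain ⟨r, hr, u, hu, hyu, hqu⟩ := thick_sep hmed hn hqy
  have hyu' : y ∈ u := hyu (mem_ball_self hr)
  have hqu' : q ∉ u := hqu (mem_ball_self hr)
  have huh : u ⊆ h := by
    intro z hz
    by_contra hzh
    exact hqu' (hu.1 y hyu' z hz (hq.2 z hzh))
  have e : u = h := hmin.eq_of_subset ⟨hu, hyu', fun hx => hxh (huh hx)⟩ huh
  subst e
  obtain ⟨q', hq'⟩ := exists_gate hmed (closure_convex hmed hh.1) isClosed_closure
    ⟨y, subset_closure hyh⟩ q
  have h1 := hq'.2 b hb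
  have h2 := (iv_trans (hq.2 b hbh) (iv_symm (hq'.2 y (subset_closure hyh)))).2
  have e := iv_antisymm h1 h2
  have hqc : q ∈ closure u := e ▸ hq'.1
  obtain ⟨w, hw, hd⟩ := Metric.mem_closure_iff.1 hqc r hr
  exact hqu (by rw [mem_ball, dist_comm]; exact hd) hw

lemma closed_super [CompleteSpace X] (hmed : IsMedianSpace X) {n : ℕ} (hn : RankLE X n)
    {x : X} {k : Set X} (hk : IsHalfspace k) (hne : k.Nonempty) {δ : ℝ} (hδ : 0 < δ)
    (hkd : ∀ z ∈ k, δ ≤ dist x z) : ∃ h, IsHalfspace h ∧ IsClosed h ∧ k ⊆ h ∧ x ∉ h := by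
  obtain ⟨p, hp⟩ := exists_gate hmed (closure_convex hmed hk.1) isClosed_closure hne.closure x
  have hxp : x ≠ p := by
    rintro rfl
    obtain ⟨w, hw, hd⟩ := Metric.mem_closure_iff.1 hp.1 δ hδ
    linarith [hkd w hw]
  obtain ⟨h, hh, hc, hph, hxh⟩ := closed_sep hmed hn hxp
  refine ⟨h, hh, hc, fun z hz => ?_, hxh⟩
  by_contra hzh
  exact hh.2 x hxh z hzh (hp.2 z (subset_closure hz)) hph

/-! ### Maximal far halfspaces -/

def Far (x : X) (δ : ℝ) (h : Set X) : Prop :=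
  IsHalfspace h ∧ h.Nonempty ∧ ∀ z ∈ h, δ ≤ dist x z

lemma exists_max_far {x : X} {δ : ℝ} {k : Set X} (hk : Far x δ k) :
    ∃ h, k ⊆ h ∧ Maximal (Far x δ) h := by
  obtain ⟨M, hAM, hM⟩ := zorn_subset_nonempty {h : Set X | Far x δ h} (by
    intro c hc hch ⟨s0, hs0⟩
    refine ⟨⋃₀ c, ⟨⟨?_, ?_⟩, ?_, ?_⟩, fun s hs => subset_sUnion_of_mem hs⟩
    · rintro a ⟨s, hs, has⟩ b ⟨t, ht, hbt⟩
      rcases hch.total hs ht with h | h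
      · exact ((hc ht).1.1 a (h has) b hbt).trans (subset_sUnion_of_mem ht)
      · exact ((hc hs).1.1 a has b (h hbt)).trans (subset_sUnion_of_mem hs)
    · rintro a ha b hb w hw ⟨s, hs, hws⟩
      exact (hc hs).1.2 a (fun h => ha ⟨s, hs, h⟩) b (fun h => hb ⟨s, hs, h⟩) hw hws
    · exact (hc hs0).2.1.mono (subset_sUnion_of_mem hs0)
    · rintro z ⟨s, hs, hzs⟩
      exact (hc hs).2.2 z hzs) k hk
  exact ⟨M, hAM, hM⟩

lemma max_far_finite {n : ℕ} (hn : RankLE X n)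
    (hnoface : ¬ ∃ h₁ h₂ h₃ : Set X,
      IsHalfspace h₁ ∧ IsHalfspace h₂ ∧ IsHalfspace h₃ ∧
      h₁.Nonempty ∧ h₂.Nonempty ∧ h₃.Nonempty ∧
      Disjoint h₁ h₂ ∧ Disjoint h₁ h₃ ∧ Disjoint h₂ h₃)
    (x : X) {δ : ℝ} (hδ : 0 < δ) : {h | Maximal (Far x δ) h}.Finite := by
  set M := {h : Set X | Maximal (Far x δ) h} with hM
  have hx : ∀ h ∈ M, x ∉ h := fun h hh hxh => by
    have := hh.prop.2.2 x hxh
    rw [dist_self] at this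
    linarith
  have dich : ∀ h ∈ M, ∀ k ∈ M, h ≠ k → ¬ Disjoint h k → Transverse h k := by
    intro h hh k hk hne hd
    refine ⟨not_disjoint_iff_nonempty_inter.1 hd, ?_, ?_, ⟨x, hx h hh, hx k hk⟩⟩
    · by_contra hcon
      rw [not_nonempty_iff_eq_empty, ← sdiff_eq, sdiff_eq_empty] at hcon
      exact hne (hh.eq_of_subset hk.prop hcon)
    · by_contra hcon
      rw [not_nonempty_iff_eq_empty, inter_comm, ← sdiff_eq, sdiff_eq_empty] at hcon
      exact hne (hk.eq_of_subset hh.prop hcon).symm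
  have hdisj : ∀ t ∈ M, {k | k ∈ M ∧ Disjoint t k}.Finite := by
    intro t ht
    refine (hn _ (fun k hk => hk.1.prop.1) ?_).1
    intro h hh k hk hne
    refine dich h hh.1 k hk.1 hne (fun hd => hnoface ?_)
    exact ⟨t, h, k, ht.prop.1, hh.1.prop.1, hk.1.prop.1, ht.prop.2.1, hh.1.prop.2.1,
      hk.1.prop.2.1, hh.2, hk.2, hd⟩
  obtain ⟨T, -, hT⟩ := zorn_subset_nonempty {T : Set (Set X) | T ⊆ M ∧ T.Pairwise Transverse} (by
    intro c hc hch hne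
    refine ⟨⋃₀ c, ⟨sUnion_subset fun s hs => (hc hs).1, ?_⟩, fun s hs => subset_sUnion_of_mem hs⟩
    exact (pairwise_sUnion hch.directedOn).2 fun s hs => (hc hs).2) ∅ ⟨empty_subset _, by simp⟩
  have hTfin : T.Finite := (hn T (fun h hh => (hT.prop.1 hh).prop.1) hT.prop.2).1
  refine (hTfin.union (hTfin.biUnion fun t ht => hdisj t (hT.prop.1 ht))).subset ?_
  intro k hk
  by_contra hcon
  simp only [mem_union, mem_iUnion, mem_ofPred_eq, not_or, not_exists, not_and] at hcon
  obtain ⟨hkT, hkd⟩ := hcon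
  have hins : insert k T ∈ {T : Set (Set X) | T ⊆ M ∧ T.Pairwise Transverse} := by
    refine ⟨insert_subset hk hT.prop.1, ?_⟩
    rintro u (rfl | hu) w (rfl | hw) hne
    · exact (hne rfl).elim
    · exact dich u hk w (hT.prop.1 hw) hne (fun hd => hkd w hw hk hd.symm)
    · exact dich u (hT.prop.1 hu) w hk hne (fun hd => hkd u hu hk hd)
    · exact hT.prop.2 hu hw hne
  have := hT.eq_of_subset hins (subset_insert _ _)
  exact hkT (by rw [this]; exact mem_insert _ _)

end MedProof

open MedProof

/-- In a complete median space of finite rank with no facing triple (no three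
pairwise disjoint nonempty halfspaces), the topology generated by the open halfspaces
coincides with the metric topology. -/
theorem stmt3 {X : Type*} [MetricSpace X] [CompleteSpace X]
    (hmed : IsMedianSpace X) (hrank : HasFiniteRank X)
    (hnoface : ¬ ∃ h₁ h₂ h₃ : Set X,
      IsHalfspace h₁ ∧ IsHalfspace h₂ ∧ IsHalfspace h₃ ∧
      h₁.Nonempty ∧ h₂.Nonempty ∧ h₃.Nonempty ∧
      Disjoint h₁ h₂ ∧ Disjoint h₁ h₃ ∧ Disjoint h₂ h₃) :
    TopologicalSpace.generateFrom {h : Set X | IsHalfspace h ∧ IsOpen h} =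
      (inferInstance : TopologicalSpace X) := by


  obtain ⟨n, hn⟩ := hrank
  have hn : RankLE X n := hn
  apply le_antisymm
  · rw [TopologicalSpace.le_def]
    intro U hU
    have hU : IsOpen U := hU
    refine @isOpen_iff_mem_nhds X (TopologicalSpace.generateFrom _) U |>.2 ?_
    intro x hx
    obtain ⟨ε, hε, hball⟩ := Metric.isOpen_iff.1 hU x hx
    set δ := ε / (n + 1) with hδ
    have hδ0 : 0 < δ := by positivity
    have hδe : δ * (n + 1) = ε := by rw [hδ]; field_simp
    have hfin := max_far_finite hn hnoface x hδ0
    have hex : ∀ k ∈ {h | Maximal (Far x δ) h}, ∃ h, IsHalfspace h ∧ IsClosed h ∧ k ⊆ h ∧ x ∉ h :=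
      fun k hk => closed_super hmed hn hk.prop.1 hk.prop.2.1 hδ0 hk.prop.2.2
    choose! f hf using hex
    have hsub : (⋂ k ∈ {h | Maximal (Far x δ) h}, (f k)ᶜ) ⊆ U := by
      intro y hy
      apply hball
      by_contra hyb
      rw [mem_ball, dist_comm, not_lt] at hyb
      have : ¬ ∀ h, IsHalfspace h → y ∈ h → ∃ z ∈ h, dist x z < δ := by
        intro H
        have := quant hmed hn hδ0 H
        nlinarith
      push Not at this
      obtain ⟨h, hh, hyh, hd⟩ := this
      obtain ⟨k, hhk, hk⟩ := exists_max_far (x := x) (δ := δ) ⟨hh, ⟨y, hyh⟩, hd⟩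
      exact mem_iInter₂.1 hy k hk ((hf k hk).2.2.1 (hhk hyh))
    refine Filter.mem_of_superset ?_ hsub
    rw [Filter.biInter_mem hfin]
    intro k hk
    refine @IsOpen.mem_nhds X (TopologicalSpace.generateFrom _) _ _ ?_ (hf k hk).2.2.2
    exact TopologicalSpace.isOpen_generateFrom_of_mem
      ⟨hs_compl (hf k hk).1, (hf k hk).2.1.isOpen_compl⟩
  · exact le_generateFrom fun s hs => hs.2
end

section
/- Let Y be a complete separable median space of finite rank and let μ be a Borel probability measure on Y. Then for every open halfspace h₀ of Y and every ε > 0 there exists a closed halfspace h of Y with h ⊆ h₀ and μ(h) > μ(h₀) − ε. -/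
open Set Metric MeasureTheory

namespace MedAux

variable {X : Type*} [MetricSpace X]

lemma mem_iff {a b c : X} : c ∈ mInterval a b ↔ dist a b = dist a c + dist c b := Iff.rfl

lemma symm' {a b c : X} (h : c ∈ mInterval a b) : c ∈ mInterval b a := by
  rw [mem_iff] at *
  rw [dist_comm b a, dist_comm b c, dist_comm c a]; linarith

lemma left_mem (a b : X) : a ∈ mInterval a b := by simp [mem_iff]

lemma right_mem (a b : X) : b ∈ mInterval a b := by simp [mem_iff]

lemma tr1 {a b c d : X} (h : c ∈ mInterval a b) (h' : d ∈ mInterval a c) : d ∈ mInterval a b := by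
  rw [mem_iff] at *
  have h1 := dist_triangle a d b
  have h2 := dist_triangle d c b
  linarith

lemma tr2 {a b c d : X} (h : c ∈ mInterval a b) (h' : d ∈ mInterval a c) : c ∈ mInterval d b := by
  rw [mem_iff] at *
  have h1 := dist_triangle a d b
  have h2 := dist_triangle d c b
  linarith

lemma eq_of_both {t x w : X} (h : x ∈ mInterval t w) (h' : t ∈ mInterval x w) : t = x := by
  rw [mem_iff] at *
  have := dist_comm t x
  have h2 : dist t x = 0 := by
    have := dist_nonneg (x := t) (y := x)
    linarith
  exact dist_eq_zero.1 h2

/-- the median -/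
noncomputable def md (hm : IsMedianSpace X) (x y z : X) : X := (hm x y z).choose

lemma md1 (hm : IsMedianSpace X) (x y z : X) : md hm x y z ∈ mInterval x y :=
  (hm x y z).choose_spec.1.1
lemma md2 (hm : IsMedianSpace X) (x y z : X) : md hm x y z ∈ mInterval x z :=
  (hm x y z).choose_spec.1.2.1
lemma md3 (hm : IsMedianSpace X) (x y z : X) : md hm x y z ∈ mInterval y z :=
  (hm x y z).choose_spec.1.2.2
lemma md_eq (hm : IsMedianSpace X) {x y z w : X} (h1 : w ∈ mInterval x y)
    (h2 : w ∈ mInterval x z) (h3 : w ∈ mInterval y z) : w = md hm x y z :=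
  (hm x y z).choose_spec.2 w ⟨h1, h2, h3⟩

lemma interval_convex (hm : IsMedianSpace X) (p q : X) : MedConvex (mInterval p q) := by
  intro c hc d hd e he
  have key : ∀ c ∈ mInterval p q, ∃ f, f = md hm p q e ∧ f ∈ mInterval c e ∧ f ∈ mInterval p q := by
    intro c hc
    set s := md hm p c e with hs
    set s' := md hm q c e with hs'
    set f := md hm s s' e with hf
    have a1 : s ∈ mInterval p c := md1 ..
    have a2 : s ∈ mInterval p e := md2 ..
    have a3 : s ∈ mInterval c e := md3 ..
    have b1 : s' ∈ mInterval q c := md1 ..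
    have b2 : s' ∈ mInterval q e := md2 ..
    have c1 : f ∈ mInterval s s' := md1 ..
    have c2 : f ∈ mInterval s e := md2 ..
    have c3 : f ∈ mInterval s' e := md3 ..
    have f1 : f ∈ mInterval p q := by
      have b1' := symm' b1
      rw [mem_iff] at *
      have := dist_triangle s c s'
      have := dist_triangle p s f
      have := dist_triangle f s' q
      have := dist_triangle p f q
      linarith
    have f2 : f ∈ mInterval p e := symm' (tr1 (symm' a2) (symm' c2))
    have f3 : f ∈ mInterval q e := symm' (tr1 (symm' b2) (symm' c3))
    have f4 : f ∈ mInterval c e := symm' (tr1 (symm' a3) (symm' c2))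
    exact ⟨f, md_eq hm f1 f2 f3, f4, f1⟩
  obtain ⟨f, hf, f1, f2⟩ := key c hc
  obtain ⟨g, hg, g1, -⟩ := key d hd
  obtain rfl : f = g := hf.trans hg.symm
  have : f = e := by
    apply dist_eq_zero.1
    rw [mem_iff] at *
    have h1 := dist_triangle c f d
    have h2 := dist_comm d e
    have h3 := dist_comm d f
    have := dist_nonneg (x := f) (y := e)
    linarith
  rwa [← this]

lemma inter_sub (hm : IsMedianSpace X) {a b c z : X} (hb : z ∈ mInterval a b)
    (hc : z ∈ mInterval a c) : z ∈ mInterval a (md hm a b c) := by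
  have h1 : md hm z b c = md hm a b c := by
    apply md_eq
    · exact interval_convex hm a b _ hb _ (right_mem _ _) (md1 hm z b c)
    · exact interval_convex hm a c _ hc _ (right_mem _ _) (md2 hm z b c)
    · exact md3 ..
  rw [← h1]
  exact symm' (tr2 (symm' hb) (symm' (md1 hm z b c)))

lemma gate_interval (hm : IsMedianSpace X) {e p u y : X} (hy : y ∈ mInterval p u) :
    md hm e p u ∈ mInterval e y := by
  set n := md hm e p u with hn
  have h1 : md hm e n y = n := by
    apply md_eq
    · exact tr1 (md1 hm e p u) (md1 hm e n y)
    · exact tr1 (md2 hm e p u) (md1 hm e n y)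
    · exact interval_convex hm p u _ (md3 hm e p u) _ hy (md3 hm e n y)
  rw [← h1]
  exact md2 ..

/-- the join of a convex set and a point is convex -/
lemma join_convex (hm : IsMedianSpace X) {h : Set X} (hh : MedConvex h) (u : X) :
    MedConvex {e | ∃ p ∈ h, e ∈ mInterval p u} := by
  rintro e1 ⟨p, hp, h1⟩ e2 ⟨q, hq, h2⟩ e he
  set r := md hm e p q
  refine ⟨r, hh p hp q hq (md3 ..), ?_⟩
  set w := md hm e r u
  have w1 : w ∈ mInterval e r := md1 ..
  have w2 : w ∈ mInterval e u := md2 ..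
  have wp : w ∈ mInterval e p := tr1 (md1 ..) w1
  have wq : w ∈ mInterval e q := tr1 (md2 ..) w1
  have w3 : w ∈ mInterval e e1 := tr1 (gate_interval hm h1) (inter_sub hm wp w2)
  have w4 : w ∈ mInterval e e2 := tr1 (gate_interval hm h2) (inter_sub hm wq w2)
  have : w = e := by
    apply dist_eq_zero.1
    rw [mem_iff] at he w3 w4
    have h1 := dist_triangle e1 w e2
    have h2 := dist_comm e1 e
    have h3 := dist_comm e1 w
    have h4 := dist_comm w e
    have := dist_nonneg (x := w) (y := e)
    linarith
  rw [← this]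
  exact md3 ..

/-- maximal convex sets missing a point -/
lemma exists_max (hm : IsMedianSpace X) {x x' : X} (hne : x ≠ x') :
    ∃ h : Set X, IsHalfspace h ∧ x ∈ h ∧ x' ∉ h ∧
      ∀ l, MedConvex l → x ∈ l → x' ∉ l → h ⊆ l → h = l := by
  obtain ⟨h, -, hmax⟩ := zorn_subset_nonempty {l : Set X | MedConvex l ∧ x ∈ l ∧ x' ∉ l} (by
    intro c hc hchain hne
    refine ⟨⋃₀ c, ⟨?_, ?_, ?_⟩, fun s hs => subset_sUnion_of_mem hs⟩
    · rintro a ⟨s, hs, ha⟩ b ⟨t, ht, hb⟩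
      rcases hchain.total hs ht with h | h
      · exact ((hc ht).1 a (h ha) b hb).trans (subset_sUnion_of_mem ht)
      · exact ((hc hs).1 a ha b (h hb)).trans (subset_sUnion_of_mem hs)
    · obtain ⟨s, hs⟩ := hne
      exact ⟨s, hs, (hc hs).2.1⟩
    · rintro ⟨s, hs, h⟩
      exact (hc hs).2.2 h) {x} ⟨by
        rintro a rfl b rfl c hc
        rw [mem_iff] at hc
        have := dist_comm b c
        have h0 := dist_self b
        exact (dist_eq_zero.1 (by linarith [dist_nonneg (x := b) (y := c)] : dist c b = 0)), rfl, fun h => hne h.symm⟩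
  obtain ⟨hconv, hx, hx'⟩ := hmax.prop
  have key : ∀ l, MedConvex l → x ∈ l → x' ∉ l → h ⊆ l → h = l := fun l h1 h2 h3 h4 =>
    hmax.eq_of_subset ⟨h1, h2, h3⟩ h4
  refine ⟨h, ⟨hconv, ?_⟩, hx, hx', key⟩
  have hj : ∀ u, u ∉ h → ∃ p ∈ h, x' ∈ mInterval p u := by
    intro u hu
    by_contra hcon
    have := key {e | ∃ p ∈ h, e ∈ mInterval p u} (join_convex hm hconv u)
      ⟨x, hx, left_mem _ _⟩ hcon (fun p hp => ⟨p, hp, left_mem _ _⟩)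
    apply hu
    rw [this]
    exact ⟨x, hx, right_mem _ _⟩
  intro u hu v hv w hw hwh
  obtain ⟨p, hp, hpu⟩ := hj u hu
  obtain ⟨q, hq, hqv⟩ := hj v hv
  set g := md hm x' p w
  set g' := md hm x' q w
  have hg : g ∈ h := hconv p hp w hwh (md3 ..)
  have hg' : g' ∈ h := hconv q hq w hwh (md3 ..)
  set t := md hm x' g g'
  have ht : t ∈ h := hconv g hg g' hg' (md3 ..)
  have tp : t ∈ mInterval x' p := tr1 (md1 ..) (md1 hm x' g g')
  have tq : t ∈ mInterval x' q := tr1 (md1 ..) (md2 hm x' g g')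
  have tw : t ∈ mInterval x' w := tr1 (md2 hm x' p w) (md1 hm x' g g')
  have xu : x' ∈ mInterval t u := tr2 hpu (symm' tp)
  have xv : x' ∈ mInterval t v := tr2 hqv (symm' tq)
  have xw : x' ∈ mInterval t w := tr1 (gate_interval hm hw) (inter_sub hm xu xv)
  have := eq_of_both xw tw
  exact hx' (this ▸ ht)

lemma Transverse.symm' {h l : Set X} (H : Transverse h l) : Transverse l h := by
  obtain ⟨h1, h2, h3, h4⟩ := H
  refine ⟨?_, ?_, ?_, ?_⟩ <;> rw [inter_comm] <;> assumption

/-- halfspaces are prime -/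
lemma half_mem {h : Set X} (hh : IsHalfspace h) {x y c : X} (hy : y ∈ mInterval x c)
    (hyh : y ∈ h) (hc : c ∉ h) : x ∈ h := by
  by_contra hx
  exact hh.2 x hx c hc hy hyh

/-- key lemma: a thick halfspace -/
lemma thick (hm : IsMedianSpace X) {n : ℕ}
    (hn : ∀ H : Set (Set X), (∀ h ∈ H, IsHalfspace h) → H.Pairwise Transverse →
      H.Finite ∧ H.ncard ≤ n) {x x' : X} {δ : ℝ} (hδ : 0 < δ)
    (hd : 2 ^ (n + 1) * δ ≤ dist x x') :
    ∃ h, IsHalfspace h ∧ x ∈ h ∧ x' ∉ h ∧ ball x δ ⊆ h := by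
  by_contra hcon
  push Not at hcon
  have main : ∀ k ≤ n + 1, ∃ H : Set (Set X), ∃ y : X, H.Finite ∧ H.ncard = k ∧
      (∀ h ∈ H, IsHalfspace h) ∧ H.Pairwise Transverse ∧ y ∈ mInterval x x' ∧
      dist x y + δ ≤ 2 ^ k * δ ∧
      ∀ h ∈ H, ∀ l, IsHalfspace l → y ∈ l → x' ∉ l → Transverse h l := by
    intro k
    induction k with
    | zero =>
      intro _
      exact ⟨∅, x, by simp, by simp, by simp, by simp, left_mem _ _, by simp, by simp⟩
    | succ k ih =>
      intro hk
      obtain ⟨H, y, Hfin, Hcard, Hhalf, Hpw, hy, hdy, Htr⟩ := ih (by omega)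
      have hne : y ≠ x' := by
        rintro rfl
        have : (2:ℝ) ^ k * δ ≤ 2 ^ (n+1) * δ := by
          gcongr
          · norm_num
          · omega
        linarith
      obtain ⟨l, lhalf, yl, x'l, lmax⟩ := exists_max hm hne
      have xl : x ∈ l := half_mem lhalf hy yl x'l
      obtain ⟨p, hp, hpl⟩ := not_subset.1 (hcon l lhalf xl x'l)
      rw [mem_ball, dist_comm] at hp
      set y' := md hm y x' p
      have y'l : y' ∉ l := lhalf.2 x' x'l p hpl (md3 ..)
      have y'1 : y' ∈ mInterval y x' := md1 ..
      have lH : l ∉ H := by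
        intro hl
        obtain ⟨-, ⟨z, hz, hz'⟩, -⟩ := Htr l hl l lhalf yl x'l
        exact hz' hz
      refine ⟨insert l H, y', Hfin.insert l, ?_, ?_, ?_, ?_, ?_, ?_⟩
      · rw [ncard_insert_of_notMem lH Hfin, Hcard]
      · rintro h (rfl | hh)
        · exact lhalf
        · exact Hhalf h hh
      · refine (pairwise_insert).2 ⟨Hpw, fun h hh _ => ?_⟩
        have := Htr h hh l lhalf yl x'l
        exact ⟨Transverse.symm' this, this⟩
      · exact symm' (tr1 (symm' hy) (symm' y'1))
      · have h1 : y' ∈ mInterval y p := md2 ..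
        rw [mem_iff] at h1
        have h2 := dist_triangle x y y'
        have h3 := dist_triangle y x p
        have h4 := dist_comm x y
        have := dist_nonneg (x := y') (y := p)
        rw [pow_succ]
        linarith
      · rintro h (rfl | hh) l' l'half y'l' x'l'
        · have yl' : y ∈ l' := half_mem l'half y'1 y'l' x'l'
          refine ⟨⟨y, yl, yl'⟩, ?_, ⟨y', y'l, y'l'⟩, ⟨x', x'l, x'l'⟩⟩
          by_contra hemp
          have hsub : h ⊆ l' := by
            intro z hz
            by_contra hz'
            exact hemp ⟨z, hz, hz'⟩
          have := lmax l' l'half.1 yl' x'l' hsub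
          exact y'l (this ▸ y'l')
        · exact Htr h hh l' l'half (half_mem l'half y'1 y'l' x'l') x'l'
  obtain ⟨H, y, -, Hcard, Hhalf, Hpw, -⟩ := main (n+1) le_rfl
  have := (hn H Hhalf Hpw).2
  omega

lemma closure_convex (hm : IsMedianSpace X) {A : Set X} (hA : MedConvex A) :
    MedConvex (closure A) := by
  intro a ha b hb c hc
  rw [Metric.mem_closure_iff] at *
  intro ε hε
  obtain ⟨a', ha', h1⟩ := ha (ε / 2) (by linarith)
  obtain ⟨b', hb', h2⟩ := hb (ε / 2) (by linarith)
  refine ⟨md hm a' b' c, hA a' ha' b' hb' (md1 ..), ?_⟩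
  have m1 := md1 hm a' b' c
  have m2 := md2 hm a' b' c
  have m3 := md3 hm a' b' c
  set m := md hm a' b' c
  rw [mem_iff] at *
  have t1 := dist_triangle a a' b
  have t2 := dist_triangle a' b' b
  have t3 := dist_triangle a' a c
  have t4 := dist_triangle b' b c
  have t5 := dist_comm a a'
  have t6 := dist_comm b b'
  have t7 := dist_comm b c
  have t8 := dist_comm m c
  have t9 := dist_comm m b'
  linarith

/-- gates -/
lemma exists_gate [CompleteSpace X] (hm : IsMedianSpace X) {A : Set X} (hA : MedConvex A)
    (hcl : IsClosed A) (hne : A.Nonempty) (c : X) : ∃ g ∈ A, ∀ a ∈ A, g ∈ mInterval c a := by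
  set D := infDist c A
  have hD : ∀ a ∈ A, D ≤ dist c a := fun a ha => infDist_le_dist_of_mem ha
  have hex : ∀ n : ℕ, ∃ a ∈ A, dist c a < D + 1 / ((n:ℝ) + 1) := fun n =>
    (infDist_lt_iff hne).1 (by have : 0 < 1 / ((n:ℝ) + 1) := by positivity
                               linarith)
  choose p hpA hp using hex
  have hest : ∀ i j, dist (p i) (p j) ≤ 1 / ((i:ℝ) + 1) + 1 / ((j:ℝ) + 1) := by
    intro i j
    have m1 := md1 hm c (p i) (p j)
    have m2 := md2 hm c (p i) (p j)
    have m3 := md3 hm c (p i) (p j)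
    have h1 := hD _ (hA _ (hpA i) _ (hpA j) m3)
    set m := md hm c (p i) (p j)
    rw [mem_iff] at *
    have := hp i
    have := hp j
    have := dist_comm m (p i)
    linarith
  have hcau : CauchySeq p := by
    apply cauchySeq_of_le_tendsto_0 (fun n : ℕ => 2 * (1 / ((n:ℝ) + 1)))
    · intro i j N hi hj
      have h1 : 1 / ((i:ℝ) + 1) ≤ 1 / ((N:ℝ) + 1) := by gcongr
      have h2 : 1 / ((j:ℝ) + 1) ≤ 1 / ((N:ℝ) + 1) := by gcongr
      linarith [hest i j]
    · simpa using (tendsto_one_div_add_atTop_nhds_zero_nat (𝕜 := ℝ)).const_mul 2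
  obtain ⟨g, hg⟩ := cauchySeq_tendsto_of_complete hcau
  have hgA : g ∈ A := hcl.mem_of_tendsto hg (Filter.Eventually.of_forall hpA)
  have hgD : dist c g ≤ D := by
    have h1 : Filter.Tendsto (fun n => dist c (p n)) Filter.atTop (nhds (dist c g)) :=
      tendsto_const_nhds.dist hg
    have h2 : Filter.Tendsto (fun n : ℕ => D + 1 / ((n:ℝ) + 1)) Filter.atTop (nhds D) := by
      simpa using (tendsto_one_div_add_atTop_nhds_zero_nat (𝕜 := ℝ)).const_add D
    exact le_of_tendsto_of_tendsto' h1 h2 (fun n => (hp n).le)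
  refine ⟨g, hgA, fun a ha => ?_⟩
  have m1 := md1 hm c g a
  have m2 := md2 hm c g a
  have h1 := hD _ (hA _ hgA _ ha (md3 hm c g a))
  set m := md hm c g a
  have : m = g := by
    apply dist_eq_zero.1
    rw [mem_iff] at m1
    linarith [dist_nonneg (x := m) (y := g)]
  rwa [this] at m2

/-- small balls lie in small closed convex sets -/
lemma small_hull (hm : IsMedianSpace X) (hrank : HasFiniteRank X) (x : X) {r : ℝ} (hr : 0 < r) :
    ∃ δ > 0, ∃ D : Set X, MedConvex D ∧ IsClosed D ∧ ball x δ ⊆ D ∧ D ⊆ ball x r := by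
  obtain ⟨n, hn⟩ := hrank
  have h2 : (0:ℝ) < 2 ^ (n+1) := by positivity
  set δ := r / 2 / 2 ^ (n+1) with hδ
  have hδ0 : 0 < δ := by positivity
  have hδ1 : 2 ^ (n+1) * δ = r / 2 := by rw [hδ]; field_simp
  set C : Set X := ⋂₀ {A | MedConvex A ∧ ball x δ ⊆ A}
  have hC : MedConvex C := by
    intro a ha b hb c hc A hA
    exact hA.1 a (ha A hA) b (hb A hA) hc
  have hCb : C ⊆ closedBall x (r/2) := by
    intro p hp
    by_contra hcon
    rw [mem_closedBall, dist_comm, not_le] at hcon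
    obtain ⟨h, hh, -, hp', hb⟩ := thick hm hn (x := x) (x' := p) hδ0 (by linarith)
    exact hp' (hp h ⟨hh.1, hb⟩)
  refine ⟨δ, hδ0, closure C, closure_convex hm hC, isClosed_closure, ?_, ?_⟩
  · exact (subset_sInter fun A hA => hA.2).trans subset_closure
  · exact (closure_minimal hCb isClosed_closedBall).trans (closedBall_subset_ball (by linarith))

/-- two-sided separation -/
lemma two_sided [CompleteSpace X] (hm : IsMedianSpace X) (hrank : HasFiniteRank X) {a x : X}
    (hne : a ≠ x) : ∃ k, IsHalfspace k ∧ x ∉ closure k ∧ ∃ δ > 0, ball a δ ⊆ k := by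
  obtain ⟨δ, hδ, D, hD, hDc, hDb, hDs⟩ := small_hull hm hrank a (dist_pos.2 hne)
  have hxD : x ∉ D := fun h => by
    have := hDs h
    rw [mem_ball, dist_comm] at this
    exact lt_irrefl _ this
  obtain ⟨g, hg, hgate⟩ := exists_gate hm hD hDc ⟨a, hDb (mem_ball_self hδ)⟩ x
  have hgx : x ≠ g := fun h => hxD (h ▸ hg)
  obtain ⟨n, hn⟩ := hrank
  have h2 : (0:ℝ) < 2 ^ (n+1) := by positivity
  have hpos := dist_pos.2 hgx
  obtain ⟨k, hk, hxk, hgk, hbk⟩ := thick hm hn (x := x) (x' := g) (δ := dist x g / 2 ^ (n+1))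
    (by positivity) (by rw [mul_div_cancel₀ _ h2.ne'])
  refine ⟨kᶜ, ⟨hk.2, by rw [compl_compl]; exact hk.1⟩, ?_, δ, hδ, ?_⟩
  · rw [closure_compl, mem_compl_iff, not_not, mem_interior_iff_mem_nhds]
    exact Filter.mem_of_superset (ball_mem_nhds x (by positivity)) hbk
  · intro p hp hpk
    exact hgk (hk.1 x hxk p hpk (hgate p (hDb hp)))

lemma step [CompleteSpace X] (hm : IsMedianSpace X) (hrank : HasFiniteRank X) {A : Set X} {x : X}
    (hA : MedConvex A) (hcl : IsClosed A) (hne : A.Nonempty) (hx : x ∉ A) :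
    ∃ k, IsHalfspace k ∧ x ∉ closure k ∧ A ⊆ interior k := by
  obtain ⟨a, ha, hgate⟩ := exists_gate hm hA hcl hne x
  obtain ⟨k, hk, hxk, δ, hδ, hb⟩ := two_sided hm hrank (a := a) (x := x) (fun h => hx (h ▸ ha))
  refine ⟨k, hk, hxk, fun a' ha' => ?_⟩
  rw [mem_interior_iff_mem_nhds]
  refine Filter.mem_of_superset (ball_mem_nhds a' hδ) fun p hp => ?_
  have h1 := hgate a' ha'
  have m1 := md1 hm a x p
  have m2 := md2 hm a x p
  have m3 := md3 hm a x p
  set m := md hm a x p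
  have hmk : m ∈ k := by
    apply hb
    rw [mem_iff] at *
    rw [mem_ball] at *
    have t1 := dist_triangle a a' p
    have t2 := dist_triangle x p a'
    have t3 := dist_comm a' p
    have t4 := dist_comm a m
    have t5 := dist_comm a x
    have t6 := dist_comm m x
    linarith
  exact half_mem hk (symm' m3) hmk (fun h => hxk (subset_closure h))

/-- an open halfspace containing `c` and not `x` -/
lemma exists_open [CompleteSpace X] (hm : IsMedianSpace X) (hrank : HasFiniteRank X) {c x : X}
    (hne : c ≠ x) : ∃ U, IsHalfspace U ∧ IsOpen U ∧ c ∈ U ∧ x ∉ U := by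
  let T := {h : Set X // IsHalfspace h ∧ c ∈ h ∧ x ∉ closure h}
  have hstep : ∀ h : T, ∃ k : T, h.1 ⊆ interior k.1 := by
    rintro ⟨h, hh, hc, hx⟩
    obtain ⟨k, hk, hxk, hs⟩ := step hm hrank (closure_convex hm hh.1) isClosed_closure
      ⟨c, subset_closure hc⟩ hx
    exact ⟨⟨k, hk, interior_subset (hs (subset_closure hc)), hxk⟩, subset_closure.trans hs⟩
  choose F hF using hstep
  obtain ⟨k0, hk0, hx0, δ, hδ, hb⟩ := two_sided hm hrank hne
  let t0 : T := ⟨k0, hk0, hb (mem_ball_self hδ), hx0⟩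
  let s : ℕ → T := fun n => F^[n] t0
  have hs : ∀ n, (s n).1 ⊆ interior (s (n+1)).1 := by
    intro n
    have : s (n+1) = F (s n) := Function.iterate_succ_apply' F n t0
    rw [this]
    exact hF _
  have hmono : Monotone fun n => (s n).1 :=
    monotone_nat_of_le_succ fun n => (hs n).trans interior_subset
  refine ⟨⋃ n, (s n).1, ⟨?_, ?_⟩, ?_, ?_, ?_⟩
  · intro a ha b hb
    obtain ⟨i, hi⟩ := mem_iUnion.1 ha
    obtain ⟨j, hj⟩ := mem_iUnion.1 hb
    exact ((s (max i j)).2.1.1 a (hmono (le_max_left i j) hi) b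
      (hmono (le_max_right i j) hj)).trans (subset_iUnion (fun n => (s n).1) _)
  · intro a ha b hb e he heU
    obtain ⟨i, hi⟩ := mem_iUnion.1 heU
    exact (s i).2.1.2 a (fun h => ha (mem_iUnion.2 ⟨i, h⟩)) b
      (fun h => hb (mem_iUnion.2 ⟨i, h⟩)) he hi
  · have : (⋃ n, (s n).1) = ⋃ n, interior (s (n+1)).1 := by
      apply subset_antisymm
      · exact iUnion_mono hs
      · exact iUnion_subset fun n => interior_subset.trans (subset_iUnion (fun n => (s n).1) _)
    rw [this]
    exact isOpen_iUnion fun n => isOpen_interior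
  · exact mem_iUnion.2 ⟨0, (s 0).2.2.1⟩
  · intro h
    obtain ⟨i, hi⟩ := mem_iUnion.1 h
    exact (s i).2.2.2 (subset_closure hi)

lemma exists_closed [CompleteSpace X] (hm : IsMedianSpace X) (hrank : HasFiniteRank X)
    {h₀ : Set X} (hh₀ : IsHalfspace h₀) (ho : IsOpen h₀) (hne : h₀ᶜ.Nonempty) {z : X}
    (hz : z ∈ h₀) : ∃ h, IsHalfspace h ∧ IsClosed h ∧ h ⊆ h₀ ∧ z ∈ h := by
  obtain ⟨g, hg, hgate⟩ := exists_gate hm hh₀.2 ho.isClosed_compl hne z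
  obtain ⟨U, hU, hUo, hgU, hzU⟩ := exists_open hm hrank (c := g) (x := z)
    (fun h => hg (h ▸ hz))
  refine ⟨Uᶜ, ⟨hU.2, by rw [compl_compl]; exact hU.1⟩, hUo.isClosed_compl, ?_, hzU⟩
  intro p hp
  by_contra hp0
  exact hU.2 z hzU p hp (hgate p hp0) hgU

lemma compact_meet [CompleteSpace X] (hm : IsMedianSpace X) (hrank : HasFiniteRank X)
    {h₀ : Set X} (hh₀ : IsHalfspace h₀) (ho : IsOpen h₀) (hne0 : h₀.Nonempty) (c : X)
    {K : Set X} (hK : IsCompact K) (hKs : K ⊆ h₀) :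
    ∃ z ∈ h₀, ∀ x ∈ K, z ∈ mInterval c x := by
  refine hK.induction_on (p := fun S => ∃ z ∈ h₀, ∀ x ∈ S, z ∈ mInterval c x) ?_ ?_ ?_ ?_
  · obtain ⟨z, hz⟩ := hne0
    exact ⟨z, hz, by simp⟩
  · rintro s t hst ⟨z, hz, h⟩
    exact ⟨z, hz, fun x hx => h x (hst hx)⟩
  · rintro s t ⟨z, hz, h⟩ ⟨w, hw, h'⟩
    refine ⟨md hm c z w, hh₀.1 z hz w hw (md3 ..), ?_⟩
    rintro x (hx | hx)
    · exact tr1 (h x hx) (md1 ..)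
    · exact tr1 (h' x hx) (md2 ..)
  · intro x hx
    obtain ⟨r, hr, hrb⟩ := Metric.isOpen_iff.1 ho x (hKs hx)
    obtain ⟨δ, hδ, D, hD, hDc, hDb, hDs⟩ := small_hull hm hrank x hr
    obtain ⟨g, hg, hgate⟩ := exists_gate hm hD hDc ⟨x, hDb (mem_ball_self hδ)⟩ c
    exact ⟨ball x δ, mem_nhdsWithin_of_mem_nhds (ball_mem_nhds x hδ), g, hrb (hDs hg),
      fun y hy => hgate y (hDb hy)⟩

end MedAux

/-- In a complete separable median space of finite rank with a Borel probability
measure, every open halfspace can be approximated from inside in measure by closed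
halfspaces. -/
theorem stmt5 {Y : Type*} [MetricSpace Y] [CompleteSpace Y]
    [TopologicalSpace.SeparableSpace Y]
    [MeasurableSpace Y] [BorelSpace Y]
    (hmed : IsMedianSpace Y) (hrank : HasFiniteRank Y)
    (μ : Measure Y) [IsProbabilityMeasure μ]
    (h₀ : Set Y) (hh₀ : IsHalfspace h₀) (hh₀open : IsOpen h₀)
    (ε : ℝ) (hε : 0 < ε) :
    ∃ h : Set Y, IsHalfspace h ∧ IsClosed h ∧ h ⊆ h₀ ∧
      (μ h₀).toReal - ε < (μ h).toReal := by
  rcases h₀ᶜ.eq_empty_or_nonempty with hC | ⟨c, hc⟩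
  · refine ⟨h₀, hh₀, ?_, subset_rfl, by linarith⟩
    rw [compl_empty_iff.1 hC]; exact isClosed_univ
  rcases h₀.eq_empty_or_nonempty with h0 | h0
  · refine ⟨h₀, hh₀, ?_, subset_rfl, by linarith⟩
    rw [h0]; exact isClosed_empty
  have hK : ∃ K ⊆ h₀, IsCompact K ∧ (μ h₀).toReal - ε < (μ K).toReal := by
    by_cases hlt : (μ h₀).toReal - ε < 0
    · exact ⟨∅, by simp, isCompact_empty, by simpa using hlt⟩
    have hpos : 0 ≤ (μ h₀).toReal - ε := not_lt.1 hlt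
    have h1 : ENNReal.ofReal ((μ h₀).toReal - ε) < μ h₀ := by
      rw [ENNReal.ofReal_lt_iff_lt_toReal hpos (measure_ne_top μ _)]
      linarith
    obtain ⟨K, hKs, ⟨hKc, -⟩, hKm⟩ :=
      innerRegular_isCompact_isClosed_measurableSet_of_finite μ hh₀open.measurableSet _ h1
    refine ⟨K, hKs, hKc, ?_⟩
    rwa [ENNReal.ofReal_lt_iff_lt_toReal hpos (measure_ne_top μ _)] at hKm
  obtain ⟨K, hKs, hKc, hKm⟩ := hK
  obtain ⟨z, hz, hzK⟩ := MedAux.compact_meet hmed hrank hh₀ hh₀open h0 c hKc hKs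
  obtain ⟨h, hh, hcl, hsub, hzh⟩ := MedAux.exists_closed hmed hrank hh₀ hh₀open ⟨c, hc⟩ hz
  refine ⟨h, hh, hcl, hsub, hKm.trans_le ?_⟩
  apply ENNReal.toReal_mono (measure_ne_top μ _)
  apply measure_mono
  intro x hx
  exact MedAux.half_mem hh (MedAux.symm' (hzK x hx)) hzh (fun h' => hc (hsub h'))
end

section
/- Let X be a connected complete median space of finite rank and let K ⊆ X be a nonempty bounded subset. For a proper nonempty halfspace h of X (∅ ≠ h ≠ X) define the depth of h in K as depth_K(h) := sup_{x∈K} d(x, h^c), and let H_K^+ denote the set of proper nonempty halfspaces h with depth_K(h) ≥ depth_K(h^c). Then the centroid c(K) := ⋂_{h ∈ H_K^+} closure(h) is a singleton; moreover, for every surjective isometry g of X, c(g(K)) = g(c(K)). -/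
open Set Metric MeasureTheory

/-- Depth of a halfspace `h` in a set `K`: `sup_{x ∈ K} d(x, hᶜ)`. -/
noncomputable def medDepth {X : Type*} [MetricSpace X] (K h : Set X) : ℝ :=
  sSup ((fun x => Metric.infDist x hᶜ) '' K)

/-- The halfspaces that are at least as deep in `K` as their complements. -/
def HKplus {X : Type*} [MetricSpace X] (K : Set X) : Set (Set X) :=
  {h : Set X | IsHalfspace h ∧ h.Nonempty ∧ hᶜ.Nonempty ∧ medDepth K hᶜ ≤ medDepth K h}

/-- The centroid set of `K`: the intersection of the closures of the halfspaces in `HKplus K`. -/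
noncomputable def centroidSet {X : Type*} [MetricSpace X] (K : Set X) : Set X :=
  ⋂ h ∈ HKplus K, closure h

section helpers

variable {X : Type*} [MetricSpace X]

lemma mi_symm {a b c : X} (h : c ∈ mInterval a b) : c ∈ mInterval b a := by
  simp only [mInterval, mem_ofPred_eq] at *
  rw [dist_comm b a, dist_comm b c, dist_comm c a]; linarith

lemma mi_left (a b : X) : a ∈ mInterval a b := by simp [mInterval]

lemma mi_right (a b : X) : b ∈ mInterval a b := by simp [mInterval]

lemma mi_trans {a b c e : X} (h : c ∈ mInterval a b) (h' : e ∈ mInterval a c) :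
    e ∈ mInterval a b := by
  simp only [mInterval, mem_ofPred_eq] at *
  have := dist_triangle a e b
  have := dist_triangle e c b
  linarith

lemma mi_trans2 {a b c e : X} (h : c ∈ mInterval a b) (h' : e ∈ mInterval a c) :
    c ∈ mInterval e b := by
  simp only [mInterval, mem_ofPred_eq] at *
  have := dist_triangle a e b
  have := dist_triangle e c b
  linarith

lemma mi_anti {x t w : X} (h : x ∈ mInterval t w) (h' : t ∈ mInterval x w) : x = t := by
  simp only [mInterval, mem_ofPred_eq] at *
  rw [dist_comm t x] at h
  have := dist_nonneg (x := x) (y := t)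
  exact dist_eq_zero.1 (by linarith)

/-- a point which is between `w` and both ends of an interval containing `w` equals `w` -/
lemma mi_collapse {u v w g : X} (hw : w ∈ mInterval u v) (h1 : g ∈ mInterval w u)
    (h2 : g ∈ mInterval w v) : g = w := by
  simp only [mInterval, mem_ofPred_eq] at *
  have := dist_triangle u g v
  rw [dist_comm w u, dist_comm g u] at h1
  have := dist_nonneg (x := w) (y := g)
  exact (dist_eq_zero.1 (by linarith : dist w g = 0)).symm

noncomputable def medp (hmed : IsMedianSpace X) (x y z : X) : X := (hmed x y z).choose

variable (hmed : IsMedianSpace X)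

lemma medp_xy (x y z : X) : medp hmed x y z ∈ mInterval x y := (hmed x y z).choose_spec.1.1
lemma medp_xz (x y z : X) : medp hmed x y z ∈ mInterval x z := (hmed x y z).choose_spec.1.2.1
lemma medp_yz (x y z : X) : medp hmed x y z ∈ mInterval y z := (hmed x y z).choose_spec.1.2.2
lemma medp_uniq {x y z m : X} (h1 : m ∈ mInterval x y) (h2 : m ∈ mInterval x z)
    (h3 : m ∈ mInterval y z) : m = medp hmed x y z :=
  (hmed x y z).choose_spec.2 m ⟨h1, h2, h3⟩

/-- The median is the gate in the interval. -/
lemma medp_gate {x a b c : X} (hc : c ∈ mInterval a b) : medp hmed x a b ∈ mInterval x c := by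
  set p := medp hmed x a c with hp
  set q := medp hmed x c b with hq
  set r := medp hmed x p q with hr
  have hp1 := medp_xy hmed x a c
  have hp2 := medp_xz hmed x a c
  have hp3 := medp_yz hmed x a c
  have hq1 := medp_xy hmed x c b
  have hq2 := medp_xz hmed x c b
  have hq3 := medp_yz hmed x c b
  have hr1 := medp_xy hmed x p q
  have hr2 := medp_xz hmed x p q
  have hr3 := medp_yz hmed x p q
  rw [← hp] at hp1 hp2 hp3
  rw [← hq] at hq1 hq2 hq3
  rw [← hr] at hr1 hr2 hr3
  have e : r = medp hmed x a b := by
    apply medp_uniq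
    · exact mi_trans hp1 hr1
    · exact mi_trans hq2 hr2
    · simp only [mInterval, mem_ofPred_eq] at hc hp3 hq3 hr3 ⊢
      have := dist_triangle a r b
      have := dist_triangle a p r
      have := dist_triangle r q b
      have := dist_triangle p c q
      have := dist_triangle a p b
      have := dist_triangle p q b
      linarith
  rw [← e]
  exact mi_trans hp2 hr1

lemma mi_convex (hmed : IsMedianSpace X) (a b : X) : MedConvex (mInterval a b) := by
  intro u hu v hv w hw
  have h1 := medp_gate hmed (x := w) hu
  have h2 := medp_gate hmed (x := w) hv
  have := mi_collapse hw h1 h2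
  rw [← this]
  exact medp_yz hmed w a b

/-- points between `w` and both `c`, `x` are between `w` and the median -/
lemma mi_below {w x c t : X} (h1 : t ∈ mInterval w x) (h2 : t ∈ mInterval w c) :
    t ∈ mInterval w (medp hmed w x c) := by
  have s1 := medp_xy hmed t x c
  have s2 := medp_xz hmed t x c
  have s3 := medp_yz hmed t x c
  set s := medp hmed t x c
  have e : s = medp hmed w x c := by
    apply medp_uniq
    · exact mi_symm (mi_trans (mi_symm h1) (mi_symm s1))
    · exact mi_symm (mi_trans (mi_symm h2) (mi_symm s2))
    · exact s3
  rw [← e]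
  exact mi_symm (mi_trans2 (mi_symm h1) (mi_symm s1))

lemma join_convex (hmed : IsMedianSpace X) {C : Set X} (hC : MedConvex C) (x : X) :
    MedConvex {w | ∃ c ∈ C, w ∈ mInterval c x} := by
  rintro u ⟨c, hc, hu⟩ v ⟨c', hc', hv⟩ w hw
  refine ⟨medp hmed w c c', hC c hc c' hc' (medp_yz hmed w c c'), ?_⟩
  set c'' := medp hmed w c c' with hc''
  have k1 := medp_xy hmed w c c'
  have k2 := medp_xz hmed w c c'
  rw [← hc''] at k1 k2
  have a1 := medp_xy hmed w c'' x
  have a2 := medp_xz hmed w c'' x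
  have a3 := medp_yz hmed w c'' x
  set w' := medp hmed w c'' x
  have b1 := mi_below hmed (mi_trans k1 a1) a2
  have b2 := mi_below hmed (mi_trans k2 a1) a2
  have := mi_collapse hw (mi_trans (medp_gate hmed hu) b1) (mi_trans (medp_gate hmed hv) b2)
  rwa [this] at a3

lemma pasch (hmed : IsMedianSpace X) {H : Set X} (hH : MedConvex H) {x u v p q w : X} (hp : p ∈ H) (hq : q ∈ H)
    (hw : w ∈ H) (h1 : x ∈ mInterval p u) (h2 : x ∈ mInterval q v) (h3 : w ∈ mInterval u v) :
    x ∈ H := by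
  have c1 := medp_xy hmed x p q
  have c2 := medp_xz hmed x p q
  have c3 := medp_yz hmed x p q
  set c := medp hmed x p q
  have t1 := medp_xy hmed w c x
  have t2 := medp_xz hmed w c x
  have t3 := medp_yz hmed w c x
  set t := medp hmed w c x
  have tp := mi_trans c1 (mi_symm t3)
  have tq := mi_trans c2 (mi_symm t3)
  have xu : x ∈ mInterval t u := mi_trans2 h1 (mi_symm tp) 
  have xv : x ∈ mInterval t v := mi_trans2 h2 (mi_symm tq) 
  have xs := mi_below hmed xu xv
  have xw : x ∈ mInterval t w := mi_trans (medp_gate hmed h3) xs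
  have e := mi_anti xw (mi_symm t2)
  have : t ∈ H := hH w hw c (hH p hp q hq c3) t1
  rwa [e]

/-- Separation of points by halfspaces. -/
lemma exists_sep (hmed : IsMedianSpace X) {x y : X} (hxy : x ≠ y) : ∃ h : Set X, IsHalfspace h ∧ y ∈ h ∧ x ∉ h := by
  obtain ⟨H, hyH, hmax⟩ := zorn_subset_nonempty {C : Set X | MedConvex C ∧ x ∉ C} (by
    intro c hc hchain hne
    refine ⟨⋃₀ c, ⟨?_, ?_⟩, fun s hs => subset_sUnion_of_mem hs⟩
    · rintro a ⟨s, hs, ha⟩ b ⟨t, ht, hb⟩ z hz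
      rcases hchain.total hs ht with h | h
      · exact ⟨t, ht, (hc ht).1 a (h ha) b hb hz⟩
      · exact ⟨s, hs, (hc hs).1 a ha b (h hb) hz⟩
    · rintro ⟨s, hs, ha⟩
      exact (hc hs).2 ha) {y} (by
    refine ⟨?_, by simpa using hxy⟩
    intro a ha b hb c hc
    rw [mem_singleton_iff] at *
    rw [ha, hb] at hc
    simp only [mInterval, mem_ofPred_eq, dist_self] at hc
    have := dist_nonneg (x := y) (y := c)
    have := dist_nonneg (x := c) (y := y)
    exact dist_eq_zero.1 (by linarith))
  have hy : y ∈ H := hyH rfl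
  refine ⟨H, ⟨hmax.prop.1, ?_⟩, hy, hmax.prop.2⟩
  have key : ∀ u ∉ H, ∃ p ∈ H, x ∈ mInterval p u := by
    intro u hu
    by_contra hcon
    have hle := hmax.le_of_ge (y := {w | ∃ c ∈ H, w ∈ mInterval c u})
      ⟨join_convex hmed hmax.prop.1 u, hcon⟩ (fun z hz => ⟨z, hz, mi_left z u⟩)
    exact hu (hle ⟨y, hy, mi_right y u⟩)
  intro u hu v hv w hw hwH
  obtain ⟨p, hp, h1⟩ := key u hu
  obtain ⟨q, hq, h2⟩ := key v hv
  exact hmax.prop.2 (pasch hmed hmax.prop.1 hp hq hwH h1 h2 hw)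

/-- Finite Helly property. -/
lemma helly (hmed : IsMedianSpace X) {ι : Type*} [Nonempty X] (s : Finset ι) : ∀ (f : ι → Set X),
    (∀ i ∈ s, MedConvex (f i)) → (∀ i ∈ s, ∀ j ∈ s, (f i ∩ f j).Nonempty) →
    (⋂ i ∈ s, f i).Nonempty := by
  classical
  induction s using Finset.induction_on with
  | empty => intro f _ _; simp
  | insert a s ha ih =>
    intro f hc hp
    rcases s.eq_empty_or_nonempty with rfl | ⟨b, hb⟩
    · have := hp a (by simp) a (by simp)
      simpa using this
    have := ih (fun i => f a ∩ f i) (by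
      intro i hi x hx y hy z hz
      exact ⟨hc a (by simp) x hx.1 y hy.1 hz, hc i (by simp [hi]) x hx.2 y hy.2 hz⟩) (by
      intro i hi j hj
      obtain ⟨x, hx1, hx2⟩ := hp a (by simp) i (by simp [hi])
      obtain ⟨y, hy1, hy2⟩ := hp a (by simp) j (by simp [hj])
      obtain ⟨z, hz1, hz2⟩ := hp i (by simp [hi]) j (by simp [hj])
      have m1 := hc a (by simp) x hx1 y hy1 (medp_xy hmed x y z)
      have m2 := hc i (by simp [hi]) x hx2 z hz1 (medp_xz hmed x y z)
      have m3 := hc j (by simp [hj]) y hy2 z hz2 (medp_yz hmed x y z)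
      exact ⟨_, ⟨m1, m2⟩, ⟨m1, m3⟩⟩)
    obtain ⟨x, hx⟩ := this
    simp only [mem_iInter, mem_inter_iff] at hx
    refine ⟨x, ?_⟩
    simp only [mem_iInter, Finset.mem_insert]
    rintro i (rfl | hi)
    · exact (hx b hb).1
    · exact (hx i hi).2

/-- Gates in closed convex subsets of a complete median space. -/
lemma exists_gate (hmed : IsMedianSpace X) [CompleteSpace X] {C : Set X} (hC : MedConvex C)
    (hcl : IsClosed C) (hne : C.Nonempty) (x : X) : ∃ y ∈ C, ∀ c ∈ C, y ∈ mInterval x c := by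
  have hex : ∀ n : ℕ, ∃ c ∈ C, dist x c < infDist x C + 1 / ((n : ℝ) + 1) := by
    intro n
    apply (infDist_lt_iff hne).1
    have : (0 : ℝ) < 1 / ((n : ℝ) + 1) := by positivity
    linarith
  choose c hcC hcd using hex
  have hbd : ∀ N n m : ℕ, N ≤ n → N ≤ m → dist (c n) (c m) ≤ 2 * (1 / ((N : ℝ) + 1)) := by
    intro N n m hn hm
    have h1 := medp_xy hmed x (c n) (c m)
    have h2 := medp_xz hmed x (c n) (c m)
    have h3 := medp_yz hmed x (c n) (c m)
    set t := medp hmed x (c n) (c m)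
    have ht : t ∈ C := hC _ (hcC n) _ (hcC m) h3
    have := infDist_le_dist_of_mem (x := x) ht
    simp only [mInterval, mem_ofPred_eq] at h1 h2 h3
    have e1 : 1 / ((n : ℝ) + 1) ≤ 1 / ((N : ℝ) + 1) := Nat.one_div_le_one_div hn
    have e2 : 1 / ((m : ℝ) + 1) ≤ 1 / ((N : ℝ) + 1) := Nat.one_div_le_one_div hm
    have := hcd n
    have := hcd m
    rw [dist_comm (c n) t] at h3
    linarith
  have hlim0 : Filter.Tendsto (fun N : ℕ => 1 / ((N : ℝ) + 1)) Filter.atTop (nhds 0) :=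
    tendsto_one_div_add_atTop_nhds_zero_nat
  have hcau : CauchySeq c := by
    apply cauchySeq_of_le_tendsto_0 (fun N : ℕ => 2 * (1 / ((N : ℝ) + 1)))
    · intro n m N h1 h2; exact hbd N n m h1 h2
    · simpa using hlim0.const_mul 2
  obtain ⟨y, hy⟩ := cauchySeq_tendsto_of_complete hcau
  have hyC : y ∈ C := hcl.mem_of_tendsto hy (Filter.Eventually.of_forall hcC)
  have hyd : dist x y ≤ infDist x C := by
    have h1 : Filter.Tendsto (fun n => dist x (c n)) Filter.atTop (nhds (dist x y)) :=
      tendsto_const_nhds.dist hy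
    have h2 := hlim0.const_add (infDist x C)
    rw [add_zero] at h2
    exact le_of_tendsto_of_tendsto' h1 h2 (fun n => (hcd n).le)
  refine ⟨y, hyC, fun z hz => ?_⟩
  have h1 := medp_xy hmed x y z
  have h2 := medp_xz hmed x y z
  have h3 := medp_yz hmed x y z
  set t := medp hmed x y z
  have ht : t ∈ C := hC _ hyC _ hz h3
  have := infDist_le_dist_of_mem (x := x) ht
  have e : t = y := by
    simp only [mInterval, mem_ofPred_eq] at h1
    have := dist_nonneg (x := t) (y := y)
    exact dist_eq_zero.1 (by linarith)
  rwa [e] at h2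

lemma medp_lip (x x' a b : X) : dist (medp hmed x a b) (medp hmed x' a b) ≤ dist x x' := by
  have h1 := medp_gate hmed (x := x) (medp_yz hmed x' a b)
  have h2 := medp_gate hmed (x := x') (medp_yz hmed x a b)
  set g := medp hmed x a b
  set g' := medp hmed x' a b
  simp only [mInterval, mem_ofPred_eq] at h1 h2
  have := dist_triangle x x' g'
  have := dist_triangle x' x g
  rw [dist_comm x' x] at this
  rw [dist_comm g' g] at h2
  linarith

lemma medp_rot (x y z : X) : medp hmed x y z = medp hmed y z x :=
  medp_uniq hmed (medp_yz hmed x y z) (mi_symm (medp_xy hmed x y z)) (mi_symm (medp_xz hmed x y z))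

lemma medp_lip2 (x y y' z : X) : dist (medp hmed x y z) (medp hmed x y' z) ≤ dist y y' := by
  rw [medp_rot hmed x y z, medp_rot hmed x y' z]; exact medp_lip hmed _ _ _ _

lemma closure_convex (hmed : IsMedianSpace X) {C : Set X} (hC : MedConvex C) : MedConvex (closure C) := by
  intro a ha b hb c hc
  rw [Metric.mem_closure_iff] at ha hb ⊢
  intro ε hε
  obtain ⟨a', ha', h1⟩ := ha (ε / 2) (by linarith)
  obtain ⟨b', hb', h2⟩ := hb (ε / 2) (by linarith)
  refine ⟨medp hmed a' b' c, hC _ ha' _ hb' (medp_xy hmed a' b' c), ?_⟩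
  have e : c = medp hmed a b c := medp_uniq hmed hc (mi_right _ _) (mi_right _ _)
  have e1 := medp_lip hmed a a' b c
  have e2 := medp_lip2 hmed a' b b' c
  have := dist_triangle (medp hmed a b c) (medp hmed a' b c) (medp hmed a' b' c)
  rw [← e] at this e1
  linarith

lemma mi_preconnected (hmed : IsMedianSpace X) [ConnectedSpace X] (a b : X) : IsPreconnected (mInterval a b) := by
  have hr : range (fun x => medp hmed x a b) = mInterval a b := by
    ext c
    constructor
    · rintro ⟨x, rfl⟩; exact medp_yz hmed x a b
    · intro hc
      exact ⟨c, (medp_uniq hmed (mi_left _ _) (mi_left _ _) hc).symm⟩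
  rw [← hr]
  apply isPreconnected_range
  have : LipschitzWith 1 (fun x => medp hmed x a b) :=
    LipschitzWith.of_dist_le_mul (fun x y => by simpa using medp_lip hmed x y a b)
  exact this.continuous

/-- Disjoint closed convex sets are at positive distance. -/
lemma pos_dist (hmed : IsMedianSpace X) [CompleteSpace X] {C D : Set X} (hC : MedConvex C)
    (hD : MedConvex D) (hCc : IsClosed C) (hDc : IsClosed D) (hCn : C.Nonempty)
    (hDn : D.Nonempty) (hdis : ¬ (C ∩ D).Nonempty) :
    ∃ δ > 0, ∀ c ∈ C, ∀ d ∈ D, δ ≤ dist c d := by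
  obtain ⟨a, ha⟩ := hCn
  obtain ⟨b, hb, hbg⟩ := exists_gate hmed hD hDc hDn a
  obtain ⟨a', ha', hag⟩ := exists_gate hmed hC hCc ⟨a, ha⟩ b
  obtain ⟨b', hb', hbg'⟩ := exists_gate hmed hD hDc hDn a'
  have e : b' = b := by
    have h1 : b ∈ mInterval a b' := hbg b' hb'
    have h2 : b' ∈ mInterval a' b := hbg' b hb
    have h3 : b' ∈ mInterval b a := mi_trans (hag a ha) (mi_symm h2)
    exact mi_anti h3 (mi_symm h1)
  subst e
  refine ⟨dist a' b', dist_pos.2 (fun h => hdis ⟨a', ha', h ▸ hb'⟩), fun c hc d hd => ?_⟩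
  have s1 := medp_xy hmed c d b'
  have s2 := medp_xz hmed c d b'
  have s3 := medp_yz hmed c d b'
  set s := medp hmed c d b'
  have hs := hbg' s (hD d hd b' hb' s3)
  have h5 := mi_symm (hag c hc)
  simp only [mInterval, mem_ofPred_eq] at s1 s2 hs h5
  have := dist_triangle a' c s
  rw [dist_comm a' c] at this
  rw [dist_comm b' s] at hs
  have := dist_nonneg (x := s) (y := d)
  linarith

/-- Joining in an interval. -/
lemma join_lemma (hmed : IsMedianSpace X) (x y : X) (r : ℝ) (F : Finset (Set X))
    (hF : ∀ f ∈ F, MedConvex f ∧ y ∈ f ∧ ∃ a ∈ f, dist x a ≤ r) :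
    ∃ w ∈ mInterval x y, (∀ f ∈ F, w ∈ f) ∧ dist x w ≤ (2 ^ F.card - 1) * r := by
  classical
  induction F using Finset.induction_on with
  | empty => exact ⟨x, mi_left x y, by simp, by simp⟩
  | insert f F hf ih =>
    obtain ⟨w, hw, hwF, hwd⟩ := ih (fun g hg => hF g (by simp [hg]))
    obtain ⟨hfc, hyf, a, haf, had⟩ := hF f (by simp)
    have m1 := medp_xy hmed w a y
    have m2 := medp_xz hmed w a y
    have m3 := medp_yz hmed w a y
    set m := medp hmed w a y
    refine ⟨m, mi_symm (mi_trans (mi_symm hw) (mi_symm m2)), ?_, ?_⟩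
    · intro g hg
      rw [Finset.mem_insert] at hg
      rcases hg with rfl | hg
      · exact hfc a haf y hyf m3
      · exact (hF g (by simp [hg])).1 w (hwF g hg) y (hF g (by simp [hg])).2.1 m2
    · rw [Finset.card_insert_of_notMem hf, pow_succ]
      simp only [mInterval, mem_ofPred_eq] at m1
      have := dist_triangle x w m
      have := dist_triangle w x a
      rw [dist_comm w x] at this
      have := dist_nonneg (x := m) (y := a)
      nlinarith

/-- Rank bound -/
def RankLe (X : Type*) [MetricSpace X] (n : ℕ) : Prop :=
  ∀ H : Set (Set X), (∀ h ∈ H, IsHalfspace h) → H.Pairwise Transverse →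
    H.Finite ∧ H.ncard ≤ n

lemma halfspace_compl {h : Set X} (hh : IsHalfspace h) : IsHalfspace hᶜ :=
  ⟨hh.2, by rw [compl_compl]; exact hh.1⟩

lemma incomparable_transverse {x y : X} {h k : Set X} (hy : y ∈ h) (ky : y ∈ k)
    (hx : x ∉ h) (kx : x ∉ k) (h1 : ¬ h ⊆ k) (h2 : ¬ k ⊆ h) : Transverse h k := by
  obtain ⟨a, ha, ha'⟩ := not_subset.1 h1
  obtain ⟨b, hb, hb'⟩ := not_subset.1 h2
  exact ⟨⟨y, hy, ky⟩, ⟨a, ha, ha'⟩, ⟨b, hb', hb⟩, ⟨x, hx, kx⟩⟩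

lemma chain_sUnion_halfspace {c : Set (Set X)} (hc : ∀ h ∈ c, IsHalfspace h)
    (hchain : IsChain (· ⊆ ·) c) : IsHalfspace (⋃₀ c) := by
  constructor
  · rintro a ⟨s, hs, ha⟩ b ⟨t, ht, hb⟩ z hz
    rcases hchain.total hs ht with h | h
    · exact ⟨t, ht, (hc t ht).1 a (h ha) b hb hz⟩
    · exact ⟨s, hs, (hc s hs).1 a ha b (h hb) hz⟩
  · rintro a ha b hb z hz ⟨s, hs, hzs⟩
    exact (hc s hs).2 a (fun h => ha ⟨s, hs, h⟩) b (fun h => hb ⟨s, hs, h⟩) hz hzs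

/-- Finitely many maximal elements in families of halfspaces separating `y` from `x`, closed
under unions of chains. -/
lemma max_family {n : ℕ} (hr : RankLe X n) (x y : X) (P : Set (Set X))
    (hP : ∀ h ∈ P, IsHalfspace h ∧ y ∈ h ∧ x ∉ h)
    (hU : ∀ c ⊆ P, IsChain (· ⊆ ·) c → c.Nonempty → ⋃₀ c ∈ P) :
    ∃ F : Finset (Set X), F.card ≤ n ∧ (∀ f ∈ F, f ∈ P) ∧ ∀ h ∈ P, ∃ f ∈ F, h ⊆ f := by
  have hfin := hr {h | Maximal (· ∈ P) h} (fun h hh => (hP h hh.prop).1) (by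
    intro h hh k hk hne
    have h1 := hP h hh.prop
    have h2 := hP k hk.prop
    refine incomparable_transverse h1.2.1 h2.2.1 h1.2.2 h2.2.2 ?_ ?_
    · intro hs
      exact hne (le_antisymm hs (hh.le_of_ge hk.prop hs))
    · intro hs
      exact hne (le_antisymm (hk.le_of_ge hh.prop hs) hs))
  refine ⟨hfin.1.toFinset, ?_, ?_, ?_⟩
  · rw [← ncard_eq_toFinset_card _ hfin.1]; exact hfin.2
  · intro f hf
    rw [Finite.mem_toFinset] at hf
    exact hf.prop
  · intro h hh
    obtain ⟨m, hm, hmm⟩ := zorn_subset_nonempty P (fun c hc hch hne =>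
      ⟨⋃₀ c, hU c hc hch hne, fun s hs => subset_sUnion_of_mem hs⟩) h hh
    exact ⟨m, by rw [Finite.mem_toFinset]; exact hmm, hm⟩

/-- Quantitative separation. -/
lemma sep_quant (hmed : IsMedianSpace X) {n : ℕ} (hr : RankLe X n) {x y : X} (hxy : x ≠ y) :
    ∃ h : Set X, IsHalfspace h ∧ y ∈ h ∧ x ∉ h ∧ ∀ a ∈ h, dist x y / 2 ^ n ≤ dist x a := by
  by_contra hcon
  push Not at hcon
  obtain ⟨F, hFc, hFP, hFm⟩ := max_family hr y x {h | IsHalfspace h ∧ x ∈ h ∧ y ∉ h}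
    (fun h hh => hh) (by
      intro c hc hch ⟨s, hs⟩
      refine ⟨chain_sUnion_halfspace (fun h hh => (hc hh).1) hch, ⟨s, hs, (hc hs).2.1⟩, ?_⟩
      rintro ⟨t, ht, hyt⟩
      exact (hc ht).2.2 hyt)
  classical
  have hpos : 0 < dist x y := dist_pos.2 hxy
  obtain ⟨w, hw, hwF, hwd⟩ := join_lemma hmed x y (dist x y / 2 ^ n) (F.image compl) (by
    intro f hf
    obtain ⟨g, hg, rfl⟩ := Finset.mem_image.1 hf
    have hgP := hFP g hg
    refine ⟨hgP.1.2, hgP.2.2, ?_⟩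
    obtain ⟨a, ha, had⟩ := hcon gᶜ (halfspace_compl hgP.1) hgP.2.2 (by simpa using hgP.2.1)
    exact ⟨a, ha, had.le⟩)
  have hne : w ≠ y := by
    rintro rfl
    have hc : (2 : ℝ) ^ (F.image compl).card ≤ 2 ^ n :=
      pow_le_pow_right₀ (by norm_num) (Finset.card_image_le.trans hFc)
    have h2 : (0 : ℝ) < 2 ^ n := by positivity
    have h3 : dist x w / 2 ^ n * 2 ^ n = dist x w := by field_simp
    have h4 : 0 < dist x w / 2 ^ n := by positivity
    nlinarith
  obtain ⟨h, hh, hy, hwh⟩ := exists_sep hmed hne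
  have hx : x ∉ h := fun hx => hwh (hh.1 x hx y hy hw)
  obtain ⟨f, hf, hsub⟩ := hFm hᶜ ⟨halfspace_compl hh, hx, by simpa using hy⟩
  exact hwF fᶜ (Finset.mem_image_of_mem _ hf) (hsub hwh)

/-- Two-sided separation. -/
lemma sep_two (hmed : IsMedianSpace X) {n : ℕ} (hr : RankLe X n) {p q : X} (hpq : p ≠ q) :
    ∃ h : Set X, IsHalfspace h ∧ q ∈ h ∧ p ∉ h ∧ p ∉ closure h ∧ q ∉ closure hᶜ := by
  have hpos : 0 < dist p q := dist_pos.2 hpq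
  have h2 : (0 : ℝ) < 2 ^ n := by positivity
  set δ := dist p q / 2 / 2 ^ n with hδ
  have hδp : 0 < δ := by positivity
  have hmem : ∀ h ∈ {h : Set X | IsHalfspace h ∧ q ∈ h ∧ ∀ a ∈ h, δ ≤ dist p a},
      IsHalfspace h ∧ q ∈ h ∧ p ∉ h := by
    rintro h ⟨h1, h2, h3⟩
    refine ⟨h1, h2, fun hp => ?_⟩
    have := h3 p hp
    rw [dist_self] at this
    linarith
  obtain ⟨F, hFc, hFP, hFm⟩ := max_family hr p q
    {h | IsHalfspace h ∧ q ∈ h ∧ ∀ a ∈ h, δ ≤ dist p a} hmem (by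
      intro c hc hch ⟨s, hs⟩
      refine ⟨chain_sUnion_halfspace (fun h hh => (hc hh).1) hch, ⟨s, hs, (hc hs).2.1⟩, ?_⟩
      rintro a ⟨t, ht, hyt⟩
      exact (hc ht).2.2 a hyt)
  have hex : ∃ f ∈ F, q ∉ closure fᶜ := by
    by_contra hcon
    push Not at hcon
    classical
    obtain ⟨b, hb, hbF, hbd⟩ := join_lemma hmed q p δ (F.image compl) (by
      intro f hf
      obtain ⟨g, hg, rfl⟩ := Finset.mem_image.1 hf
      refine ⟨(hFP g hg).1.2, (hmem g (hFP g hg)).2.2, ?_⟩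
      obtain ⟨a, ha, had⟩ := Metric.mem_closure_iff.1 (hcon g hg) δ hδp
      exact ⟨a, ha, had.le⟩)
    have hc : (2 : ℝ) ^ (F.image compl).card ≤ 2 ^ n :=
      pow_le_pow_right₀ (by norm_num) (Finset.card_image_le.trans hFc)
    have h3 : δ * 2 ^ n = dist p q / 2 := by rw [hδ]; field_simp
    have hqb : dist q b ≤ dist p q / 2 := by nlinarith
    have hpb : dist p q / 2 ≤ dist p b := by
      have := dist_triangle p b q
      rw [dist_comm b q] at this
      linarith
    have hne : p ≠ b := by
      rintro rfl
      rw [dist_self] at hpb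
      linarith
    obtain ⟨h, hh, hbh, hph, hdh⟩ := sep_quant hmed hr hne
    have hqh : q ∈ h := by
      by_contra hq
      exact hh.2 q hq p hph hb hbh
    obtain ⟨f, hf, hsub⟩ := hFm h ⟨hh, hqh, fun a ha => by
      refine le_trans ?_ (hdh a ha)
      rw [hδ]
      gcongr⟩
    exact hbF fᶜ (Finset.mem_image_of_mem _ hf) (hsub hbh)
  obtain ⟨f, hf, hqf⟩ := hex
  refine ⟨f, (hFP f hf).1, (hFP f hf).2.1, (hmem f (hFP f hf)).2.2, ?_, hqf⟩
  intro hcl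
  obtain ⟨a, ha, had⟩ := Metric.mem_closure_iff.1 hcl δ hδp
  have := (hFP f hf).2.2 a ha
  linarith

lemma depth_bdd {K h : Set X} (hK : Bornology.IsBounded K) (hne : h.Nonempty) :
    BddAbove ((fun x => infDist x h) '' K) := by
  obtain ⟨a, ha⟩ := hne
  obtain ⟨r, hr⟩ := hK.subset_closedBall a
  refine ⟨r, ?_⟩
  rintro _ ⟨x, hx, rfl⟩
  exact (infDist_le_dist_of_mem ha).trans (hr hx)

lemma le_depth {K h : Set X} (hK : Bornology.IsBounded K) (hne : hᶜ.Nonempty) {x : X}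
    (hx : x ∈ K) : infDist x hᶜ ≤ medDepth K h :=
  le_csSup (depth_bdd hK hne) ⟨x, hx, rfl⟩

lemma K_meets {K h : Set X} (hKne : K.Nonempty) (hK : Bornology.IsBounded K)
    (hh : h ∈ HKplus K) : (K ∩ closure h).Nonempty := by
  by_contra hcon
  obtain ⟨hh1, hne, hne', hle⟩ := hh
  obtain ⟨x, hx⟩ := hKne
  have hxh : x ∉ closure h := fun h' => hcon ⟨x, hx, h'⟩
  have h1 : 0 < infDist x h := by
    rcases (infDist_nonneg (x := x) (s := h)).lt_or_eq with h' | h'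
    · exact h'
    · exact absurd ((mem_closure_iff_infDist_zero hne).2 h'.symm) hxh
  have h2 : infDist x hᶜᶜ ≤ medDepth K hᶜ := le_depth hK (by simpa using hne) hx
  rw [compl_compl] at h2
  have h3 : medDepth K h ≤ 0 := by
    apply csSup_le (Set.Nonempty.image _ ⟨x, hx⟩)
    rintro _ ⟨z, hz, rfl⟩
    have hzc : z ∈ hᶜ := fun hz' => hcon ⟨z, hz, subset_closure hz'⟩
    exact (infDist_zero_of_mem hzc).le
  linarith

lemma depth_step (hmed : IsMedianSpace X) [ConnectedSpace X] {K h k : Set X}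
    (hKne : K.Nonempty) (hK : Bornology.IsBounded K) (hh : h ∈ HKplus K) (hk : k ∈ HKplus K)
    {δ : ℝ} (hδ : 0 < δ) (hd : ∀ c ∈ closure h, ∀ d ∈ closure k, δ ≤ dist c d) :
    medDepth K h + δ ≤ medDepth K kᶜ := by
  have hkn := hk.2.1
  have key : ∀ x ∈ closure h, infDist x hᶜ + δ ≤ infDist x k := by
    intro x hx
    apply (le_infDist hkn).2
    intro y hy
    have hyh : y ∉ h := by
      intro hyh
      have := hd y (subset_closure hyh) y (subset_closure hy)
      rw [dist_self] at this
      linarith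
    obtain ⟨z, hz, hz1, hz2⟩ := isPreconnected_closed_iff.1 (mi_preconnected hmed x y)
      (closure h) (closure hᶜ) isClosed_closure isClosed_closure
      (fun z _ => by
        by_cases hz : z ∈ h
        · exact Or.inl (subset_closure hz)
        · exact Or.inr (subset_closure hz))
      ⟨x, mi_left _ _, hx⟩ ⟨y, mi_right _ _, subset_closure hyh⟩
    have e1 : infDist x hᶜ ≤ dist x z := by
      rw [← infDist_closure]
      exact infDist_le_dist_of_mem hz2
    have e2 := hd z hz1 y (subset_closure hy)
    simp only [mInterval, mem_ofPred_eq] at hz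
    linarith
  have key2 : ∀ x ∈ K, x ∈ closure h → infDist x hᶜ + δ ≤ medDepth K kᶜ := by
    intro x hx hxh
    have := le_depth (h := kᶜ) hK (by simpa using hkn) hx
    rw [compl_compl] at this
    exact (key x hxh).trans this
  obtain ⟨x0, hx0K, hx0⟩ := K_meets hKne hK hh
  suffices medDepth K h ≤ medDepth K kᶜ - δ by linarith
  apply csSup_le (hKne.image _)
  rintro _ ⟨x, hx, rfl⟩
  by_cases hxh : x ∈ h
  · have := key2 x hx (subset_closure hxh)
    simp only
    linarith
  · have e : infDist x hᶜ = 0 := infDist_zero_of_mem hxh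
    have := key2 x0 hx0K hx0
    have := infDist_nonneg (x := x0) (s := hᶜ)
    simp only [e]
    linarith

lemma closures_meet (hmed : IsMedianSpace X) [CompleteSpace X] [ConnectedSpace X] {K h k : Set X}
    (hKne : K.Nonempty) (hK : Bornology.IsBounded K) (hh : h ∈ HKplus K) (hk : k ∈ HKplus K) :
    (closure h ∩ closure k).Nonempty := by
  by_contra hcon
  obtain ⟨δ, hδ, hd⟩ := pos_dist hmed (closure_convex hmed hh.1.1) (closure_convex hmed hk.1.1)
    isClosed_closure isClosed_closure hh.2.1.closure hk.2.1.closure hcon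
  have h1 := depth_step hmed hKne hK hh hk hδ hd
  have h2 := depth_step hmed hKne hK hk hh hδ
    (fun c hc d hd' => by rw [dist_comm]; exact hd d hd' c hc)
  have h3 := hh.2.2.2
  have h4 := hk.2.2.2
  linarith

lemma centroid_nonempty (hmed : IsMedianSpace X) [CompleteSpace X] [ConnectedSpace X] {n : ℕ}
    (hr : RankLe X n) {K : Set X} (hKne : K.Nonempty) (hK : Bornology.IsBounded K) :
    (centroidSet K).Nonempty := by
  classical
  obtain ⟨x, hx⟩ := hKne
  obtain ⟨D, hD⟩ := hK.subset_closedBall x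
  let C : Finset (HKplus K) → Set X := fun s => ⋂ i ∈ s, closure i.1
  have hCconv : ∀ s, MedConvex (C s) := by
    intro s a ha b hb c hc
    simp only [C, mem_iInter] at *
    intro i hi
    exact closure_convex hmed i.2.1.1 a (ha i hi) b (hb i hi) hc
  have hCcl : ∀ s, IsClosed (C s) := fun s =>
    isClosed_biInter (fun i _ => isClosed_closure)
  have hCne : ∀ s, (C s).Nonempty := fun s =>
    helly hmed s (fun i => closure i.1) (fun i _ => closure_convex hmed i.2.1.1)
      (fun i _ j _ => closures_meet hmed ⟨x, hx⟩ hK i.2 j.2)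
  choose y hyC hyg using fun s => exists_gate hmed (hCconv s) (hCcl s) (hCne s) x
  have h2 : (0 : ℝ) < 2 ^ n := by positivity
  have hD0 : 0 ≤ D := by simpa using hD hx
  have hbd : ∀ s, dist x (y s) ≤ 2 ^ n * D := by
    intro s
    by_cases hxy : x = y s
    · rw [← hxy, dist_self]; positivity
    obtain ⟨h, hh, hyh, hxh, hdh⟩ := sep_quant hmed hr hxy
    have hex : ∃ i ∈ s, closure i.1 ⊆ h := by
      by_contra hcon
      push Not at hcon
      have hz : ∃ z ∈ C s, z ∉ h := by
        rcases s.eq_empty_or_nonempty with rfl | ⟨b, hb⟩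
        · exact ⟨x, by simp [C], hxh⟩
        obtain ⟨z, hz⟩ := helly hmed s (fun i => closure i.1 ∩ hᶜ) (by
          intro i _ a ha b hb c hc
          exact ⟨closure_convex hmed i.2.1.1 a ha.1 b hb.1 hc, hh.2 a ha.2 b hb.2 hc⟩) (by
          intro i hi j hj
          obtain ⟨a, ha, ha'⟩ := not_subset.1 (hcon i hi)
          obtain ⟨b, hb, hb'⟩ := not_subset.1 (hcon j hj)
          obtain ⟨c, hc, hc'⟩ := closures_meet hmed ⟨x, hx⟩ hK i.2 j.2
          have m1 := hh.2 a ha' b hb' (medp_xy hmed a b c)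
          have m2 := closure_convex hmed i.2.1.1 a ha c hc (medp_xz hmed a b c)
          have m3 := closure_convex hmed j.2.1.1 b hb c hc' (medp_yz hmed a b c)
          exact ⟨_, ⟨m2, m1⟩, ⟨m3, m1⟩⟩)
        simp only [mem_iInter] at hz
        refine ⟨z, ?_, (hz b hb).2⟩
        simp only [C, mem_iInter]
        exact fun i hi => (hz i hi).1
      obtain ⟨z, hzC, hzh⟩ := hz
      exact hh.2 x hxh z hzh (hyg s z hzC) hyh
    obtain ⟨i, hi, hsub⟩ := hex
    obtain ⟨k, hkK, hki⟩ := K_meets ⟨x, hx⟩ hK i.2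
    have h3 := hdh k (hsub hki)
    have h4 : dist x k ≤ D := by rw [dist_comm]; exact hD hkK
    rw [div_le_iff₀ h2] at h3
    nlinarith
  have hmono : ∀ s t, s ⊆ t → y s ∈ mInterval x (y t) := by
    intro s t hst
    apply hyg s
    have := hyC t
    simp only [C, mem_iInter] at this ⊢
    exact fun i hi => this i (hst hi)
  have hcau : CauchySeq y := by
    rw [Metric.cauchySeq_iff']
    intro ε hε
    have hB : BddAbove (range fun s => dist x (y s)) := ⟨_, by rintro _ ⟨s, rfl⟩; exact hbd s⟩
    obtain ⟨_, ⟨s, rfl⟩, hs⟩ := exists_lt_of_lt_csSup (range_nonempty fun s => dist x (y s))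
      (sub_lt_self (sSup (range fun s => dist x (y s))) hε)
    refine ⟨s, fun t hst => ?_⟩
    have h5 := hmono s t hst
    have h6 := le_csSup hB ⟨t, rfl⟩
    simp only [mInterval, mem_ofPred_eq] at h5 h6 hs
    rw [dist_comm]
    linarith
  obtain ⟨p, hp⟩ := cauchySeq_tendsto_of_complete hcau
  refine ⟨p, ?_⟩
  simp only [centroidSet, mem_iInter]
  intro h hh
  refine isClosed_closure.mem_of_tendsto hp ?_
  filter_upwards [Filter.eventually_ge_atTop {⟨h, hh⟩}] with s hs
  have := hyC s
  simp only [C, mem_iInter] at this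
  exact this ⟨h, hh⟩ (hs (by simp))

lemma preimage_convex (g : X ≃ᵢ X) {C : Set X} (hC : MedConvex C) :
    MedConvex ((g : X → X) ⁻¹' C) := by
  intro a ha b hb c hc
  refine hC (g a) ha (g b) hb ?_
  simp only [mInterval, mem_ofPred_eq, g.dist_eq] at *
  exact hc

lemma depth_preimage (g : X ≃ᵢ X) (K h : Set X) :
    medDepth K ((g : X → X) ⁻¹' h) = medDepth ((g : X → X) '' K) h := by
  unfold medDepth
  rw [image_image]
  congr 1
  apply image_congr
  intro x _
  rw [← preimage_compl, ← infDist_image g.isometry, image_preimage_eq _ g.surjective]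

lemma centroid_sub (g : X ≃ᵢ X) (K : Set X) :
    (g : X → X) '' centroidSet K ⊆ centroidSet ((g : X → X) '' K) := by
  rintro _ ⟨p, hp, rfl⟩
  simp only [centroidSet, mem_iInter] at hp ⊢
  rintro h ⟨hh, hne, hne', hle⟩
  have := hp ((g : X → X) ⁻¹' h) ⟨⟨preimage_convex g hh.1, by
      rw [← preimage_compl]; exact preimage_convex g hh.2⟩, hne.preimage g.surjective, by
      rw [← preimage_compl]; exact hne'.preimage g.surjective, by
      rw [← preimage_compl, depth_preimage, depth_preimage]; exact hle⟩
  have h2 := g.toHomeomorph.preimage_closure h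
  rw [IsometryEquiv.coe_toHomeomorph] at h2
  rw [← h2] at this
  exact this

end helpers

/-- In a connected complete median space of finite rank, the centroid set of a
nonempty bounded subset is a singleton, and it is equivariant under surjective isometries. -/
theorem stmt6 {X : Type*} [MetricSpace X] [CompleteSpace X] [ConnectedSpace X]
    (hmed : IsMedianSpace X) (hrank : HasFiniteRank X)
    (K : Set X) (hKne : K.Nonempty) (hKbdd : Bornology.IsBounded K) :
    (∃ p : X, centroidSet K = {p}) ∧
    (∀ g : X ≃ᵢ X, centroidSet ((g : X → X) '' K) = (g : X → X) '' centroidSet K) := by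
  constructor
  · obtain ⟨n, hn⟩ := hrank
    have hr : RankLe X n := hn
    obtain ⟨p, hp⟩ := centroid_nonempty hmed hr hKne hKbdd
    refine ⟨p, Subset.antisymm ?_ (by simpa using hp)⟩
    intro q hq
    rw [mem_singleton_iff]
    by_contra hne
    obtain ⟨h, hh, hqh, hph, hpc, hqc⟩ := sep_two hmed hr (Ne.symm hne)
    simp only [centroidSet, mem_iInter] at hp hq
    rcases le_total (medDepth K hᶜ) (medDepth K h) with hle | hle
    · exact hpc (hp h ⟨hh, ⟨q, hqh⟩, ⟨p, hph⟩, hle⟩)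
    · exact hqc (hq hᶜ ⟨halfspace_compl hh, ⟨p, hph⟩, ⟨q, by simpa using hqh⟩, by
        rw [compl_compl]; exact hle⟩)
  · intro g
    refine Subset.antisymm ?_ (centroid_sub g K)
    intro p hp
    refine ⟨g.symm p, ?_, by simp⟩
    have := centroid_sub g.symm ((g : X → X) '' K) ⟨p, hp, rfl⟩
    rw [image_image] at this
    simpa using this
end
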